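/- arXiv:1203.4124 — 2 statements merged into one kernel-verified Lean document; each statement's English description precedes it below -/
import Mathlib

section
/- Let p ≥ 2 and K > 0. There exists a constant C > 0, depending only on p and K, such that for every real Banach space B with modulus of uniform convexity η(ε) = K ε^p, every f ∈ ℓ^p(B), and every sequence (t_k)_{k≥1} of positive integers with t_k ∈ [2^{k−1}, 2^k) for each k ≥ 1, one has ∑_{k≥1} ‖A_{t_k} f − ℰ_k f‖_{ℓ^p(B)}^p ≤ C ‖f‖_{ℓ^p(B)}^p. -/
open Finset ENNReal NNReal

/-- The shift ergodic averages on `ℤ`: `(A_n f)(x) = (1/n) ∑_{i<n} f (x + i)`. -/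
noncomputable def shiftAvg {B : Type*} [AddCommGroup B] [Module ℝ B]
    (n : ℕ) (f : ℤ → B) (x : ℤ) : B :=
  (n : ℝ)⁻¹ • ∑ i ∈ Finset.range n, f (x + (i : ℤ))

/-- The dyadic expectation `(ℰ_n f)(x)`: the average of `f` over the dyadic interval
`[h·2ⁿ, (h+1)·2ⁿ)` of length `2ⁿ` containing `x`, where `h = ⌊x / 2ⁿ⌋`. -/
noncomputable def dyadicExp {B : Type*} [AddCommGroup B] [Module ℝ B]
    (n : ℕ) (f : ℤ → B) (x : ℤ) : B :=
  ((2 : ℝ) ^ n)⁻¹ • ∑ j ∈ Finset.range (2 ^ n), f (Int.fdiv x (2 ^ n) * 2 ^ n + (j : ℤ))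

/-- The Clarkson inequality for the real numbers `1` and `s`. -/
theorem scalar_clarkson {p s : ℝ} (hp : 2 ≤ p) (h0 : 0 ≤ s) (h1 : s ≤ 1) :
    ((1 + s) / 2) ^ p + ((1 - s) / 2) ^ p ≤ (1 + s ^ p) / 2 := by
  have key : ∀ a : ℝ, 0 ≤ a → a ^ p = (a ^ 2) ^ (p / 2) := by
    intro a ha
    rw [← Real.rpow_natCast, ← Real.rpow_mul ha]
    congr 1
    push_cast
    ring
  have ha : 0 ≤ (1 + s) / 2 := by linarith
  have hb : 0 ≤ (1 - s) / 2 := by linarith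
  have hconv := (convexOn_rpow (show 1 ≤ p / 2 by linarith)).2 (Set.mem_Ici.2 zero_le_one)
    (Set.mem_Ici.2 (sq_nonneg s)) (by norm_num : (0 : ℝ) ≤ 1 / 2) (by norm_num : (0 : ℝ) ≤ 1 / 2)
    (by norm_num)
  simp only [smul_eq_mul] at hconv
  rw [← key s h0, Real.one_rpow] at hconv
  calc ((1 + s) / 2) ^ p + ((1 - s) / 2) ^ p
      = (((1 + s) / 2) ^ 2) ^ (p / 2) + (((1 - s) / 2) ^ 2) ^ (p / 2) := by
        rw [key _ ha, key _ hb]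
    _ ≤ (((1 + s) / 2) ^ 2 + ((1 - s) / 2) ^ 2) ^ (p / 2) :=
        Real.add_rpow_le_rpow_add (sq_nonneg _) (sq_nonneg _) (by linarith)
    _ = (1 / 2 * 1 + 1 / 2 * s ^ 2) ^ (p / 2) := by congr 1; ring
    _ ≤ (1 + s ^ p) / 2 := by linarith

/-- The constant in the two-point inequality `two_point`. -/
noncomputable def cotypeConst (p K : ℝ) : ℝ := min 1 (2 * K) / 2 ^ (p - 1)

theorem cotypeConst_pos {p K : ℝ} (hK : 0 < K) : 0 < cotypeConst p K := by
  unfold cotypeConst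
  positivity

/-- The modulus of uniform convexity of `B` is at least `K * ε ^ p`. -/
def HasPowerConvexity (B : Type*) [NormedAddCommGroup B] [NormedSpace ℝ B] (p K : ℝ) : Prop :=
  ∀ ε ∈ Set.Ioc (0 : ℝ) 2, ∀ x y : B, ‖x‖ ≤ 1 → ‖y‖ ≤ 1 → ε ≤ ‖x - y‖ →
    ‖(1 / 2 : ℝ) • (x + y)‖ ≤ 1 - K * ε ^ p

section
variable {B : Type*} [NormedAddCommGroup B] [NormedSpace ℝ B] {p K : ℝ}

theorem norm_midpoint_le (hp : 2 ≤ p) (hK : 0 < K) (hB : HasPowerConvexity B p K)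
    {x z : B} (hx : ‖x‖ = 1) (hz : ‖z‖ = 1) {s : ℝ} (h0 : 0 ≤ s) (h1 : s ≤ 1) :
    ‖(1 / 2 : ℝ) • (x + s • z)‖ ≤ (1 + s) / 2 - K * (s * ‖x - z‖) ^ p := by
  have hmid : ‖(1 / 2 : ℝ) • (x + z)‖ ≤ 1 - K * ‖x - z‖ ^ p := by
    rcases (norm_nonneg (x - z)).eq_or_lt with h | h
    · rw [← h, Real.zero_rpow (by linarith), mul_zero, sub_zero, norm_smul]
      have := norm_add_le x z
      norm_num
      linarith
    · refine hB _ ⟨h, ?_⟩ x z hx.le hz.le le_rfl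
      have := norm_sub_le x z
      linarith
  have hs : s ^ p ≤ s := by
    simpa using Real.rpow_le_rpow_of_exponent_ge' h0 h1 zero_le_one (by linarith : 1 ≤ p)
  have hsplit : (1 / 2 : ℝ) • (x + s • z) = ((1 - s) / 2) • x + s • ((1 / 2 : ℝ) • (x + z)) := by
    module
  have hpow : K * (s * ‖x - z‖) ^ p ≤ s * (K * ‖x - z‖ ^ p) := by
    rw [Real.mul_rpow h0 (norm_nonneg _)]
    have : 0 ≤ K * ‖x - z‖ ^ p := by positivity
    nlinarith
  calc ‖(1 / 2 : ℝ) • (x + s • z)‖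
      ≤ (1 - s) / 2 * ‖x‖ + s * ‖(1 / 2 : ℝ) • (x + z)‖ := by
        rw [hsplit]
        refine (norm_add_le _ _).trans_eq ?_
        rw [norm_smul, norm_smul s, Real.norm_of_nonneg h0,
          Real.norm_of_nonneg (by linarith : 0 ≤ (1 - s) / 2)]
    _ ≤ (1 - s) / 2 * 1 + s * (1 - K * ‖x - z‖ ^ p) := by
        rw [hx]; gcongr
    _ ≤ _ := by linarith

theorem two_point_of_norm_eq_one (hp : 2 ≤ p) (hK : 0 < K) (hB : HasPowerConvexity B p K)
    {x y : B} (hx : ‖x‖ = 1) (hy : ‖y‖ ≤ 1) :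
    ‖(1 / 2 : ℝ) • (x + y)‖ ^ p + cotypeConst p K * ‖(1 / 2 : ℝ) • (x - y)‖ ^ p
      ≤ (1 + ‖y‖ ^ p) / 2 := by
  obtain ⟨z, hz, hyz⟩ : ∃ z : B, ‖z‖ = 1 ∧ ‖y‖ • z = y := by
    rcases eq_or_ne y 0 with rfl | h
    · exact ⟨x, hx, by simp⟩
    · exact ⟨‖y‖⁻¹ • y, norm_smul_inv_norm h, by simp [smul_smul, h]⟩
  have h0 := norm_nonneg y
  generalize ‖y‖ = s at *
  subst hyz
  have hmid := norm_midpoint_le hp hK hB hx hz h0 hy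
  have hscal := scalar_clarkson hp h0 hy
  set a := s * ‖x - z‖
  have ha : 0 ≤ a := by positivity
  set u := (1 + s) / 2 with hu_def
  set d := (1 - s) / 2 with hd_def
  have hd : 0 ≤ d := by linarith
  have hu : 1 / 2 ≤ u := by linarith
  set m := ‖(1 / 2 : ℝ) • (x + s • z)‖
  have hm : 0 ≤ m := norm_nonneg _
  have hv : 0 ≤ K * a ^ p := by positivity
  have hp2 : (1 / 2 : ℝ) ^ (p - 1) ≤ u ^ (p - 1) :=
    Real.rpow_le_rpow (by norm_num) hu (by linarith)
  have hup : m ^ p ≤ u ^ p - 2 * K * (a / 2) ^ p := by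
    have hsub : ∀ r : ℝ, 0 < r → r ^ p = r * r ^ (p - 1) := fun r hr => by
      rw [Real.rpow_sub_one hr.ne']
      field_simp
    have hhalf : (1 / 2 : ℝ) ^ (p - 1) * a ^ p = 2 * (a / 2) ^ p := by
      rw [div_eq_mul_one_div a, Real.mul_rpow ha (by norm_num), hsub (1 / 2) (by norm_num)]
      ring
    have hmp : m ^ p ≤ m * u ^ (p - 1) := by
      rcases hm.eq_or_lt with h | h
      · rw [← h, Real.zero_rpow (by linarith), zero_mul]
      · rw [hsub m h]
        gcongr
        · linarith
        · linarith
    have hu1 : 0 ≤ u ^ (p - 1) := by positivity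
    calc m ^ p ≤ m * u ^ (p - 1) := hmp
      _ ≤ (u - K * a ^ p) * u ^ (p - 1) := by gcongr
      _ = u ^ p - u ^ (p - 1) * (K * a ^ p) := by rw [hsub u (by linarith)]; ring
      _ ≤ u ^ p - (1 / 2 : ℝ) ^ (p - 1) * (K * a ^ p) := by gcongr
      _ = u ^ p - 2 * K * (a / 2) ^ p := by linear_combination -K * hhalf
  have hdiff : ‖(1 / 2 : ℝ) • (x - s • z)‖ ≤ a / 2 + d := by
    have hsplit : (1 / 2 : ℝ) • (x - s • z) = (s / 2) • (x - z) + d • x := by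
      rw [hd_def]; module
    rw [hsplit]
    refine (norm_add_le _ _).trans_eq ?_
    rw [norm_smul, norm_smul, Real.norm_of_nonneg hd, hx,
      Real.norm_of_nonneg (by positivity : 0 ≤ s / 2)]
    ring
  have hsum : (a / 2 + d) ^ p ≤ 2 ^ (p - 1) * ((a / 2) ^ p + d ^ p) := by
    have := NNReal.rpow_add_le_mul_rpow_add_rpow ⟨a / 2, by positivity⟩ ⟨d, hd⟩
      (by linarith : 1 ≤ p)
    exact_mod_cast this
  have hcd : cotypeConst p K * ‖(1 / 2 : ℝ) • (x - s • z)‖ ^ p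
      ≤ 2 * K * (a / 2) ^ p + d ^ p := by
    have hmin1 : min 1 (2 * K) ≤ 1 := min_le_left _ _
    have hmin2 : min 1 (2 * K) ≤ 2 * K := min_le_right _ _
    have hA : 0 ≤ (a / 2) ^ p := by positivity
    have hD : 0 ≤ d ^ p := by positivity
    calc cotypeConst p K * ‖(1 / 2 : ℝ) • (x - s • z)‖ ^ p
        ≤ cotypeConst p K * (2 ^ (p - 1) * ((a / 2) ^ p + d ^ p)) :=
          mul_le_mul_of_nonneg_left
            ((Real.rpow_le_rpow (norm_nonneg _) hdiff (by linarith)).trans hsum)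
            (cotypeConst_pos hK).le
      _ = min 1 (2 * K) * ((a / 2) ^ p + d ^ p) := by
          unfold cotypeConst
          have : (2 : ℝ) ^ (p - 1) ≠ 0 := by positivity
          field_simp
      _ ≤ _ := by nlinarith
  linarith

/-- The two-point inequality of a space with modulus of uniform convexity `K * ε ^ p`. -/
theorem two_point (hp : 2 ≤ p) (hK : 0 < K) (hB : HasPowerConvexity B p K) (x y : B) :
    ‖(1 / 2 : ℝ) • (x + y)‖ ^ p + cotypeConst p K * ‖(1 / 2 : ℝ) • (x - y)‖ ^ p
      ≤ (‖x‖ ^ p + ‖y‖ ^ p) / 2 := by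
  wlog hxy : ‖y‖ ≤ ‖x‖ generalizing x y
  · have := this y x (le_of_not_ge hxy)
    rwa [add_comm y, ← neg_sub x, smul_neg, norm_neg, add_comm (‖y‖ ^ p)] at this
  rcases eq_or_ne x 0 with rfl | hx
  · obtain rfl : y = 0 := by simpa using hxy
    simp [Real.zero_rpow (by linarith : p ≠ 0)]
  have hx' : 0 < ‖x‖ := norm_pos_iff.2 hx
  have hscale : ∀ v : B, ‖v‖ ^ p = ‖x‖ ^ p * ‖‖x‖⁻¹ • v‖ ^ p := fun v => by
    rw [← Real.mul_rpow hx'.le (norm_nonneg _), norm_smul, norm_inv, norm_norm,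
      mul_inv_cancel_left₀ hx'.ne']
  have h := two_point_of_norm_eq_one hp hK hB (x := ‖x‖⁻¹ • x) (y := ‖x‖⁻¹ • y)
    (norm_smul_inv_norm hx) (by
      rw [norm_smul, norm_inv, norm_norm, inv_mul_le_iff₀ hx', mul_one]; exact hxy)
  rw [← smul_add, ← smul_sub, smul_comm, smul_comm (1 / 2 : ℝ)] at h
  rw [hscale ((1 / 2 : ℝ) • (x + y)), hscale ((1 / 2 : ℝ) • (x - y)), hscale y]
  have hpos : 0 ≤ ‖x‖ ^ p := by positivity
  nlinarith [mul_le_mul_of_nonneg_left h hpos]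
end
section
variable {B : Type*} [NormedAddCommGroup B] [NormedSpace ℝ B]

/-- The average of `f` over the `h`-th dyadic interval of length `2 ^ j`. -/
noncomputable def dyadicMean (j : ℕ) (f : ℤ → B) (h : ℤ) : B :=
  ((2 : ℝ) ^ j)⁻¹ • ∑ i ∈ Finset.range (2 ^ j), f (h * 2 ^ j + (i : ℤ))

/-- Half the difference of the averages of `f` over the two halves of the `h`-th dyadic interval
of length `2 ^ (j + 1)`. -/
noncomputable def dyadicHalfDiff (j : ℕ) (f : ℤ → B) (h : ℤ) : B :=
  (1 / 2 : ℝ) • (dyadicMean j f (2 * h) - dyadicMean j f (2 * h + 1))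

/-- The dyadic martingale difference. -/
noncomputable def dyadicDiff (j : ℕ) (f : ℤ → B) (x : ℤ) : B :=
  dyadicExp j f x - dyadicExp (j + 1) f x

theorem dyadicExp_eq_dyadicMean (j : ℕ) (f : ℤ → B) (x : ℤ) :
    dyadicExp j f x = dyadicMean j f (x / 2 ^ j) := by
  rw [dyadicExp, dyadicMean, Int.fdiv_eq_ediv_of_nonneg _ (by positivity)]

theorem dyadicMean_zero (f : ℤ → B) (h : ℤ) : dyadicMean 0 f h = f h := by
  simp [dyadicMean]

theorem dyadicMean_succ (j : ℕ) (f : ℤ → B) (h : ℤ) :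
    dyadicMean (j + 1) f h
      = (1 / 2 : ℝ) • (dyadicMean j f (2 * h) + dyadicMean j f (2 * h + 1)) := by
  have h1 : ∀ i : ℕ, h * 2 ^ (j + 1) + (i : ℤ) = 2 * h * 2 ^ j + i := fun i => by ring
  have h2 : ∀ i : ℕ, h * 2 ^ (j + 1) + ((2 ^ j + i : ℕ) : ℤ) = (2 * h + 1) * 2 ^ j + i :=
    fun i => by push_cast; ring
  rw [dyadicMean, dyadicMean, dyadicMean, ← smul_add, smul_smul, pow_succ, mul_inv, mul_comm,
    pow_succ (2 : ℕ), mul_two, Finset.sum_range_add, one_div]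
  simp_rw [h2, h1]

theorem dyadicDiff_eq (j : ℕ) (f : ℤ → B) (x : ℤ) :
    dyadicDiff j f x = if x / 2 ^ j % 2 = 0 then dyadicHalfDiff j f (x / 2 ^ j / 2)
      else -dyadicHalfDiff j f (x / 2 ^ j / 2) := by
  have hq : x / 2 ^ (j + 1) = x / 2 ^ j / 2 := by
    rw [pow_succ, Int.ediv_ediv_of_nonneg (by positivity)]
  rw [dyadicDiff, dyadicExp_eq_dyadicMean, dyadicExp_eq_dyadicMean, hq, dyadicMean_succ,
    dyadicHalfDiff]
  generalize x / 2 ^ j = q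
  split_ifs with h
  · rw [show 2 * (q / 2) = q by omega]
    module
  · rw [show 2 * (q / 2) + 1 = q by omega]
    module

theorem enorm_dyadicDiff (j : ℕ) (f : ℤ → B) (x : ℤ) :
    ‖dyadicDiff j f x‖ₑ = ‖dyadicHalfDiff j f (x / 2 ^ j / 2)‖ₑ := by
  rw [dyadicDiff_eq]
  split_ifs <;> simp

/-- A discrete antiderivative of the martingale difference `dyadicDiff j f`. -/
noncomputable def dyadicTent (j : ℕ) (f : ℤ → B) (x : ℤ) : B :=
  (if x / 2 ^ j % 2 = 0 then ((x % 2 ^ j : ℤ) : ℝ) else 2 ^ j - ((x % 2 ^ j : ℤ) : ℝ)) •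
    dyadicHalfDiff j f (x / 2 ^ j / 2)

theorem dyadicTent_add_one_sub (j : ℕ) (f : ℤ → B) (x : ℤ) :
    dyadicTent j f (x + 1) - dyadicTent j f x = dyadicDiff j f x := by
  rw [dyadicDiff_eq, dyadicTent, dyadicTent]
  have hN : (0 : ℤ) < 2 ^ j := by positivity
  have hNr : ((2 ^ j : ℤ) : ℝ) = 2 ^ j := by norm_cast
  have hr := Int.emod_nonneg x hN.ne'
  have hr' := Int.emod_lt_of_pos x hN
  have hx := Int.mul_ediv_add_emod x (2 ^ j)
  rw [← hNr]
  generalize (2 : ℤ) ^ j = N at *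
  generalize x / N = q at *
  generalize x % N = r at *
  subst hx
  rcases (Int.add_one_le_iff.2 hr').eq_or_lt with h | h
  · obtain rfl : r = N - 1 := by omega
    have e : N * q + (N - 1) + 1 = N * (q + 1) := by ring
    rw [e, Int.mul_ediv_cancel_left _ hN.ne', Int.mul_emod_right]
    by_cases hq : q % 2 = 0
    · rw [if_neg (by omega), if_pos hq, if_pos hq, show (q + 1) / 2 = q / 2 by omega]
      push_cast
      module
    · rw [if_pos (by omega), if_neg hq, if_neg hq]
      push_cast
      module
  · have e1 : (N * q + r + 1) / N = q := by
      rw [add_assoc, Int.mul_add_ediv_left _ _ hN.ne', Int.ediv_eq_zero_of_lt (by omega) h, add_zero]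
    have e2 : (N * q + r + 1) % N = r + 1 := by
      rw [add_assoc, Int.mul_add_emod_self_left, Int.emod_eq_of_lt (by omega) h]
    rw [e1, e2]
    split_ifs
    · push_cast
      module
    · push_cast
      module

theorem dyadicTent_eq_zero {j : ℕ} (f : ℤ → B) {x : ℤ} (hx : 2 ^ (j + 1) ∣ x) :
    dyadicTent j f x = 0 := by
  obtain ⟨y, rfl⟩ := hx
  have hN : (2 : ℤ) ^ j ≠ 0 := by positivity
  simp [dyadicTent, pow_succ, mul_assoc, Int.mul_ediv_cancel_left _ hN]

theorem enorm_dyadicTent_le (j : ℕ) (f : ℤ → B) (x : ℤ) :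
    ‖dyadicTent j f x‖ₑ ≤ 2 ^ j * ‖dyadicHalfDiff j f (x / 2 ^ j / 2)‖ₑ := by
  rw [dyadicTent, enorm_smul]
  gcongr
  have hN : (0 : ℤ) < 2 ^ j := by positivity
  have hr : (0 : ℝ) ≤ ((x % 2 ^ j : ℤ) : ℝ) := by exact_mod_cast Int.emod_nonneg x hN.ne'
  have hr' : ((x % 2 ^ j : ℤ) : ℝ) ≤ 2 ^ j := by exact_mod_cast (Int.emod_lt_of_pos x hN).le
  rw [Real.enorm_eq_ofReal_abs, ← ENNReal.ofReal_ofNat 2, ← ENNReal.ofReal_pow (by norm_num)]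
  apply ENNReal.ofReal_le_ofReal
  split_ifs
  · rwa [abs_of_nonneg hr]
  · rw [abs_of_nonneg (by linarith)]
    linarith

theorem sum_range_dyadicDiff (j n : ℕ) (f : ℤ → B) (x : ℤ) :
    ∑ i ∈ Finset.range n, dyadicDiff j f (x + i) = dyadicTent j f (x + n) - dyadicTent j f x := by
  have h := Finset.sum_range_sub (fun i : ℕ => dyadicTent j f (x + i)) n
  rw [Nat.cast_zero, add_zero] at h
  rw [← h]
  refine Finset.sum_congr rfl fun i _ => ?_
  rw [← dyadicTent_add_one_sub]
  push_cast
  rw [add_assoc]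

theorem dyadicExp_dyadicDiff_of_lt {j k : ℕ} (hjk : j < k) (f : ℤ → B) (x : ℤ) :
    dyadicExp k (dyadicDiff j f) x = 0 := by
  rw [dyadicExp, sum_range_dyadicDiff]
  have hd : (2 : ℤ) ^ (j + 1) ∣ 2 ^ k := pow_dvd_pow 2 hjk
  rw [dyadicTent_eq_zero f (hd.mul_left _), dyadicTent_eq_zero f, sub_zero, smul_zero]
  push_cast
  exact (hd.mul_left _).add hd

theorem dyadicDiff_congr {j : ℕ} (f : ℤ → B) {x y : ℤ} (h : x / 2 ^ j = y / 2 ^ j) :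
    dyadicDiff j f x = dyadicDiff j f y := by
  rw [dyadicDiff_eq, dyadicDiff_eq, h]

theorem dyadicExp_dyadicDiff_of_le {j k : ℕ} (hkj : k ≤ j) (f : ℤ → B) (x : ℤ) :
    dyadicExp k (dyadicDiff j f) x = dyadicDiff j f x := by
  have hk : (0 : ℤ) < 2 ^ k := by positivity
  have hconst : ∀ i ∈ Finset.range (2 ^ k),
      dyadicDiff j f (Int.fdiv x (2 ^ k) * 2 ^ k + (i : ℤ)) = dyadicDiff j f x := by
    intro i hi
    apply dyadicDiff_congr
    have hi' : (i : ℤ) < 2 ^ k := by exact_mod_cast Finset.mem_range.1 hi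
    rw [Int.fdiv_eq_ediv_of_nonneg _ hk.le, ← Nat.add_sub_of_le hkj, pow_add,
      ← Int.ediv_ediv_of_nonneg hk.le, ← Int.ediv_ediv_of_nonneg hk.le, add_comm,
      Int.add_mul_ediv_right _ _ hk.ne', Int.ediv_eq_zero_of_lt (by positivity) hi', zero_add]
  rw [dyadicExp, Finset.sum_congr rfl hconst, Finset.sum_const, Finset.card_range,
    ← Nat.cast_smul_eq_nsmul ℝ, smul_smul]
  push_cast
  rw [inv_mul_cancel₀ (by positivity), one_smul]

end
theorem tsum_int_eq_tsum_sum_range (m : ℕ) [NeZero m] (F : ℤ → ℝ≥0∞) :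
    ∑' x, F x = ∑' h : ℤ, ∑ r ∈ Finset.range m, F (h * m + r) := by
  rw [← (Int.divModEquiv m).symm.tsum_eq, ENNReal.tsum_prod']
  refine tsum_congr fun h => ?_
  rw [tsum_fintype, Finset.sum_range]
  rfl

theorem tsum_int_ediv (m : ℕ) [NeZero m] (F : ℤ → ℝ≥0∞) :
    ∑' x : ℤ, F (x / m) = m * ∑' h, F h := by
  rw [tsum_int_eq_tsum_sum_range m, ← ENNReal.tsum_mul_left]
  refine tsum_congr fun h => ?_
  have hm : (m : ℤ) ≠ 0 := NeZero.ne _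
  have hconst : ∀ r ∈ Finset.range m, F ((h * m + r) / m) = F h := fun r hr => by
    have hr' : (r : ℤ) < m := by exact_mod_cast Finset.mem_range.1 hr
    rw [add_comm, Int.add_mul_ediv_right _ _ hm, Int.ediv_eq_zero_of_lt (by positivity) hr',
      zero_add]
  rw [Finset.sum_congr rfl hconst, Finset.sum_const, Finset.card_range, nsmul_eq_mul]

theorem tsum_int_ediv_two_pow (j : ℕ) (F : ℤ → ℝ≥0∞) :
    ∑' x : ℤ, F (x / 2 ^ j) = 2 ^ j * ∑' h, F h := by
  have h := tsum_int_ediv (2 ^ j) F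
  push_cast at h
  exact h

theorem tsum_int_ediv_two_pow_succ (j : ℕ) (F : ℤ → ℝ≥0∞) :
    ∑' x : ℤ, F (x / 2 ^ j / 2) = 2 ^ (j + 1) * ∑' h, F h := by
  rw [← tsum_int_ediv_two_pow]
  refine tsum_congr fun x => ?_
  rw [pow_succ, Int.ediv_ediv_of_nonneg (by positivity)]

theorem tsum_int_add_right (a : ℤ) (F : ℤ → ℝ≥0∞) : ∑' x : ℤ, F (x + a) = ∑' x, F x :=
  (Equiv.addRight a).tsum_eq F

section
variable {B : Type*} [NormedAddCommGroup B] [NormedSpace ℝ B] {p K : ℝ}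

/-- The `p`-th power of the `ℓ^p` norm of `dyadicExp j f`. -/
noncomputable def dyadicExpEnergy (p : ℝ) (j : ℕ) (f : ℤ → B) : ℝ≥0∞ :=
  2 ^ j * ∑' h, ‖dyadicMean j f h‖ₑ ^ p

/-- The `p`-th power of the `ℓ^p` norm of `dyadicDiff j f`. -/
noncomputable def dyadicDiffEnergy (p : ℝ) (j : ℕ) (f : ℤ → B) : ℝ≥0∞ :=
  2 ^ (j + 1) * ∑' h, ‖dyadicHalfDiff j f h‖ₑ ^ p

theorem dyadicExpEnergy_zero (p : ℝ) (f : ℤ → B) :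
    dyadicExpEnergy p 0 f = ∑' x, ‖f x‖ₑ ^ p := by
  simp [dyadicExpEnergy, dyadicMean_zero]

theorem enorm_two_point (hp : 2 ≤ p) (hK : 0 < K) (hB : HasPowerConvexity B p K) (x y : B) :
    2 * (‖(1 / 2 : ℝ) • (x + y)‖ₑ ^ p
      + ENNReal.ofReal (cotypeConst p K) * ‖(1 / 2 : ℝ) • (x - y)‖ₑ ^ p)
      ≤ ‖x‖ₑ ^ p + ‖y‖ₑ ^ p := by
  have hp0 : 0 ≤ p := by linarith
  have hc := (cotypeConst_pos (p := p) hK).le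
  have h := two_point hp hK hB x y
  have hpow : ∀ v : B, ‖v‖ₑ ^ p = ENNReal.ofReal (‖v‖ ^ p) := fun v => by
    rw [← ofReal_norm, ENNReal.ofReal_rpow_of_nonneg (norm_nonneg _) hp0]
  simp only [hpow]
  rw [← ENNReal.ofReal_mul hc, ← ENNReal.ofReal_add (by positivity) (by positivity),
    ← ENNReal.ofReal_add (by positivity) (by positivity), ← ENNReal.ofReal_ofNat 2,
    ← ENNReal.ofReal_mul (by norm_num)]
  apply ENNReal.ofReal_le_ofReal
  linarith

theorem dyadicExpEnergy_succ_add_le (hp : 2 ≤ p) (hK : 0 < K) (hB : HasPowerConvexity B p K)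
    (j : ℕ) (f : ℤ → B) :
    dyadicExpEnergy p (j + 1) f + ENNReal.ofReal (cotypeConst p K) * dyadicDiffEnergy p j f
      ≤ dyadicExpEnergy p j f := by
  have hsplit : ∑' h, ‖dyadicMean j f h‖ₑ ^ p
      = ∑' h, (‖dyadicMean j f (2 * h)‖ₑ ^ p + ‖dyadicMean j f (2 * h + 1)‖ₑ ^ p) := by
    rw [tsum_int_eq_tsum_sum_range 2]
    refine tsum_congr fun h => ?_
    simp [Finset.sum_range_succ, mul_comm]
  rw [dyadicExpEnergy, dyadicExpEnergy, dyadicDiffEnergy, hsplit, mul_left_comm, ← mul_add,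
    ← ENNReal.tsum_mul_left, ← ENNReal.tsum_add, pow_succ, mul_assoc, ← ENNReal.tsum_mul_left]
  gcongr with h
  rw [dyadicMean_succ, dyadicHalfDiff]
  exact enorm_two_point hp hK hB _ _

theorem dyadicExpEnergy_add_sum_le (hp : 2 ≤ p) (hK : 0 < K) (hB : HasPowerConvexity B p K)
    (f : ℤ → B) (N : ℕ) :
    dyadicExpEnergy p N f
      + ENNReal.ofReal (cotypeConst p K) * ∑ j ∈ Finset.range N, dyadicDiffEnergy p j f
      ≤ ∑' x, ‖f x‖ₑ ^ p := by
  induction N with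
  | zero => simp [dyadicExpEnergy_zero]
  | succ N ih =>
    refine le_trans ?_ ih
    rw [Finset.sum_range_succ, mul_add, add_comm (_ * _), ← add_assoc]
    gcongr
    exact dyadicExpEnergy_succ_add_le hp hK hB N f

/-- The Pisier cotype inequality for the dyadic martingale differences. -/
theorem mul_tsum_dyadicDiffEnergy_le (hp : 2 ≤ p) (hK : 0 < K) (hB : HasPowerConvexity B p K)
    (f : ℤ → B) :
    ENNReal.ofReal (cotypeConst p K) * ∑' j, dyadicDiffEnergy p j f ≤ ∑' x, ‖f x‖ₑ ^ p := by
  rw [← ENNReal.tsum_mul_left]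
  refine ENNReal.tsum_le_of_sum_range_le fun N => ?_
  rw [← Finset.mul_sum]
  exact le_add_self.trans (dyadicExpEnergy_add_sum_le hp hK hB f N)

theorem tendsto_dyadicExp (hp : 2 ≤ p) (hK : 0 < K) (hB : HasPowerConvexity B p K)
    {f : ℤ → B} (hf : ∑' x, ‖f x‖ₑ ^ p ≠ ⊤) (x : ℤ) :
    Filter.Tendsto (fun N => dyadicExp N f x) Filter.atTop (nhds 0) := by
  have hp0 : 0 < p := by linarith
  have hbound : ∀ N, ‖dyadicExp N f x‖ₑ ≤ ((2⁻¹ : ℝ≥0∞) ^ N * ∑' x, ‖f x‖ₑ ^ p) ^ p⁻¹ := by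
    intro N
    rw [ENNReal.le_rpow_inv_iff hp0, ← ENNReal.inv_pow, ← ENNReal.div_eq_inv_mul,
      ENNReal.le_div_iff_mul_le (by simp) (by simp), mul_comm]
    refine le_trans ?_ (le_self_add.trans (dyadicExpEnergy_add_sum_le hp hK hB f N))
    rw [dyadicExpEnergy, dyadicExp_eq_dyadicMean]
    gcongr
    exact ENNReal.le_tsum (f := fun h => ‖dyadicMean N f h‖ₑ ^ p) _
  rw [tendsto_zero_iff_enorm_tendsto_zero]
  refine tendsto_of_tendsto_of_tendsto_of_le_of_le tendsto_const_nhds ?_ (fun _ => zero_le) hbound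
  have h0 : Filter.Tendsto (fun N : ℕ => (2⁻¹ : ℝ≥0∞) ^ N * ∑' x, ‖f x‖ₑ ^ p)
      Filter.atTop (nhds 0) := by
    have := ENNReal.Tendsto.mul_const
      (ENNReal.tendsto_pow_atTop_nhds_zero_of_lt_one (by simp : (2⁻¹ : ℝ≥0∞) < 1))
      (Or.inr hf)
    rwa [zero_mul] at this
  have := h0.ennrpow_const p⁻¹
  rwa [ENNReal.zero_rpow_of_pos (by positivity)] at this

/-- The difference of a shift average and a dyadic expectation. -/
noncomputable def avgSubExp (t k : ℕ) (f : ℤ → B) (x : ℤ) : B :=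
  shiftAvg t f x - dyadicExp k f x

theorem avgSubExp_sub (t k : ℕ) (f g : ℤ → B) (x : ℤ) :
    avgSubExp t k (fun y => f y - g y) x = avgSubExp t k f x - avgSubExp t k g x := by
  simp only [avgSubExp, shiftAvg, dyadicExp, Finset.sum_sub_distrib, smul_sub]
  abel

theorem avgSubExp_eq_sum_add (t k : ℕ) (f : ℤ → B) (x : ℤ) (N : ℕ) :
    avgSubExp t k f x = ∑ j ∈ Finset.range N, avgSubExp t k (dyadicDiff j f) x
      + avgSubExp t k (dyadicExp N f) x := by
  induction N with
  | zero =>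
    have : dyadicExp 0 f = f := by
      ext y
      simp [dyadicExp_eq_dyadicMean, dyadicMean_zero]
    simp [this]
  | succ N ih =>
    have h : avgSubExp t k (dyadicDiff N f) x = _ :=
      avgSubExp_sub t k (dyadicExp N f) (dyadicExp (N + 1) f) x
    rw [Finset.sum_range_succ, h, ih]
    abel

theorem enorm_avgSubExp_le_tsum (hp : 2 ≤ p) (hK : 0 < K) (hB : HasPowerConvexity B p K)
    {f : ℤ → B} (hf : ∑' x, ‖f x‖ₑ ^ p ≠ ⊤) (t k : ℕ) (x : ℤ) :
    ‖avgSubExp t k f x‖ₑ ≤ ∑' j, ‖avgSubExp t k (dyadicDiff j f) x‖ₑ := by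
  have hlim : Filter.Tendsto (fun N => avgSubExp t k (dyadicExp N f) x) Filter.atTop (nhds 0) := by
    have hsum : ∀ (n : ℕ) (a : ℝ) (y : ℤ), Filter.Tendsto
        (fun N => a • ∑ i ∈ Finset.range n, dyadicExp N f (y + (i : ℤ)))
        Filter.atTop (nhds 0) := fun n a y => by
      have := (tendsto_finsetSum (Finset.range n) fun i _ =>
        tendsto_dyadicExp hp hK hB hf (y + (i : ℤ))).const_smul a
      simpa using this
    have := (hsum t (t : ℝ)⁻¹ x).sub
      (hsum (2 ^ k) ((2 : ℝ) ^ k)⁻¹ (Int.fdiv x (2 ^ k) * 2 ^ k))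
    rwa [sub_zero] at this
  have hlim' := (tendsto_zero_iff_enorm_tendsto_zero.1 hlim).const_add
    (∑' j, ‖avgSubExp t k (dyadicDiff j f) x‖ₑ)
  rw [add_zero] at hlim'
  refine ge_of_tendsto' hlim' fun N => ?_
  rw [avgSubExp_eq_sum_add t k f x N]
  refine (enorm_add_le _ _).trans ?_
  gcongr
  exact (enorm_sum_le _ _).trans (ENNReal.sum_le_tsum _)

end
theorem two_rpow_sub_one_mul_two (p : ℝ) : (2 : ℝ≥0∞) ^ (p - 1) * 2 = 2 ^ p := by
  simpa using (ENNReal.rpow_add (p - 1) 1 two_ne_zero ENNReal.ofNat_ne_top).symm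

section
variable {B : Type*} [NormedAddCommGroup B] [NormedSpace ℝ B] {p K : ℝ}

theorem enorm_avgSubExp_dyadicDiff_le_of_le {j k t : ℕ} (hjk : j ≤ k) (ht : 2 ^ k ≤ t)
    (f : ℤ → B) (x : ℤ) :
    ‖avgSubExp t (k + 1) (dyadicDiff j f) x‖ₑ ≤ 2⁻¹ ^ (k - j) *
      (‖dyadicHalfDiff j f ((x + t) / 2 ^ j / 2)‖ₑ + ‖dyadicHalfDiff j f (x / 2 ^ j / 2)‖ₑ) := by
  have ht0 : 0 < t := lt_of_lt_of_le (by positivity) ht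
  have hinv : ‖(t : ℝ)⁻¹‖ₑ ≤ 2⁻¹ ^ k := by
    rw [enorm_inv (by positivity), ← ENNReal.inv_pow, ENNReal.inv_le_inv,
      Real.enorm_natCast]
    exact_mod_cast ht
  have hpow : (2⁻¹ : ℝ≥0∞) ^ k * 2 ^ j = 2⁻¹ ^ (k - j) := by
    obtain ⟨m, rfl⟩ := Nat.exists_eq_add_of_le hjk
    rw [Nat.add_sub_cancel_left, pow_add, mul_right_comm, ← mul_pow,
      ENNReal.inv_mul_cancel (by simp) (by simp), one_pow, one_mul]
  rw [avgSubExp, dyadicExp_dyadicDiff_of_lt (Nat.lt_succ_of_le hjk), sub_zero, shiftAvg,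
    sum_range_dyadicDiff, enorm_smul, ← hpow, mul_assoc, mul_add]
  gcongr
  exact enorm_sub_le.trans (add_le_add (enorm_dyadicTent_le _ _ _) (enorm_dyadicTent_le _ _ _))

theorem tsum_avgSubExp_dyadicDiff_le_of_le (hp : 2 ≤ p) {j k t : ℕ} (hjk : j ≤ k)
    (ht : 2 ^ k ≤ t) (f : ℤ → B) :
    ∑' x, ‖avgSubExp t (k + 1) (dyadicDiff j f) x‖ₑ ^ p
      ≤ 2 ^ p * (2⁻¹ ^ (k - j) * dyadicDiffEnergy p j f) := by
  have hp0 : 0 ≤ p := by linarith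
  set U : ℤ → ℝ≥0∞ := fun h => ‖dyadicHalfDiff j f h‖ₑ ^ p
  set θ : ℝ≥0∞ := 2⁻¹ ^ (k - j)
  have hθp : θ ^ p ≤ θ := by
    have hθ1 : θ ≤ 1 := pow_le_one' (by simp) _
    simpa using ENNReal.rpow_le_rpow_of_exponent_ge hθ1 (by linarith : 1 ≤ p)
  have hpt : ∀ x, ‖avgSubExp t (k + 1) (dyadicDiff j f) x‖ₑ ^ p
      ≤ θ * (2 ^ (p - 1) * (U ((x + t) / 2 ^ j / 2) + U (x / 2 ^ j / 2))) := fun x => by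
    refine (ENNReal.rpow_le_rpow (enorm_avgSubExp_dyadicDiff_le_of_le hjk ht f x) hp0).trans ?_
    rw [ENNReal.mul_rpow_of_nonneg _ _ hp0]
    exact mul_le_mul' hθp (ENNReal.rpow_add_le_mul_rpow_add_rpow _ _ (by linarith))
  refine (ENNReal.tsum_le_tsum hpt).trans_eq ?_
  rw [ENNReal.tsum_mul_left, ENNReal.tsum_mul_left, ENNReal.tsum_add,
    tsum_int_add_right (t : ℤ) (fun x => U (x / 2 ^ j / 2)), tsum_int_ediv_two_pow_succ,
    ← two_mul, dyadicDiffEnergy, ← two_rpow_sub_one_mul_two p]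
  ring

theorem enorm_avgSubExp_dyadicDiff_le_of_ge {j k t : ℕ} (hkj : k ≤ j) (ht0 : 0 < t)
    (ht : t < 2 ^ k) (f : ℤ → B) (x : ℤ) :
    ‖avgSubExp t k (dyadicDiff j f) x‖ₑ ≤ if 2 ^ j < x % 2 ^ j + 2 ^ k then
      2 * (‖dyadicHalfDiff j f (x / 2 ^ j / 2)‖ₑ + ‖dyadicHalfDiff j f ((x / 2 ^ j + 1) / 2)‖ₑ)
      else 0 := by
  have hN : (0 : ℤ) < 2 ^ j := by positivity
  have hkj' : (2 : ℤ) ^ k ≤ 2 ^ j := pow_le_pow_right₀ (by norm_num) hkj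
  have ht' : (t : ℤ) < 2 ^ k := by exact_mod_cast ht
  have ht0' : (t : ℝ) ≠ 0 := by positivity
  have hx := Int.mul_ediv_add_emod x (2 ^ j)
  have hr := Int.emod_nonneg x hN.ne'
  have hr' := Int.emod_lt_of_pos x hN
  rw [avgSubExp, dyadicExp_dyadicDiff_of_le hkj, shiftAvg]
  split_ifs with hif
  · set a := ‖dyadicHalfDiff j f (x / 2 ^ j / 2)‖ₑ
    set b := ‖dyadicHalfDiff j f ((x / 2 ^ j + 1) / 2)‖ₑ
    have hterm : ∀ i ∈ Finset.range t, ‖dyadicDiff j f (x + i)‖ₑ ≤ a + b := by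
      intro i hi
      have hi' : (i : ℤ) < t := by exact_mod_cast Finset.mem_range.1 hi
      have hq : (x + i) / 2 ^ j = x / 2 ^ j ∨ (x + i) / 2 ^ j = x / 2 ^ j + 1 := by
        have h1 : x / 2 ^ j ≤ (x + i) / 2 ^ j := Int.ediv_le_ediv hN (by omega)
        have h2 : (x + i) / 2 ^ j < x / 2 ^ j + 2 := by
          rw [Int.ediv_lt_iff_lt_mul hN, add_mul, mul_comm (x / 2 ^ j)]
          omega
        omega
      rw [enorm_dyadicDiff]
      rcases hq with hq | hq <;> rw [hq]
      · exact le_self_add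
      · exact le_add_self
    have havg : ‖(t : ℝ)⁻¹ • ∑ i ∈ Finset.range t, dyadicDiff j f (x + i)‖ₑ ≤ a + b := by
      rw [enorm_smul, enorm_inv ht0', Real.enorm_natCast, ← ENNReal.div_eq_inv_mul]
      apply ENNReal.div_le_of_le_mul'
      refine (enorm_sum_le _ _).trans ((Finset.sum_le_sum hterm).trans_eq ?_)
      rw [Finset.sum_const, Finset.card_range, nsmul_eq_mul]
    rw [two_mul]
    refine enorm_sub_le.trans (add_le_add havg ?_)
    rw [enorm_dyadicDiff]
    exact le_self_add
  · have hterm : ∀ i ∈ Finset.range t, dyadicDiff j f (x + i) = dyadicDiff j f x := by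
      intro i hi
      have hi' : (i : ℤ) < t := by exact_mod_cast Finset.mem_range.1 hi
      apply dyadicDiff_congr
      have h1 : x / 2 ^ j ≤ (x + i) / 2 ^ j := Int.ediv_le_ediv hN (by omega)
      have h2 : (x + i) / 2 ^ j < x / 2 ^ j + 1 := by
        rw [Int.ediv_lt_iff_lt_mul hN, add_mul, mul_comm (x / 2 ^ j)]
        omega
      omega
    rw [Finset.sum_congr rfl hterm, Finset.sum_const, Finset.card_range,
      ← Nat.cast_smul_eq_nsmul ℝ, smul_smul, inv_mul_cancel₀ ht0', one_smul, sub_self, enorm_zero]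

theorem tsum_ite_emod_le {j k : ℕ} (hkj : k ≤ j) (G : ℤ → ℝ≥0∞) :
    ∑' x : ℤ, (if 2 ^ j < x % 2 ^ j + 2 ^ k then G (x / 2 ^ j) else 0) ≤ 2 ^ k * ∑' h, G h := by
  have hN : (0 : ℤ) < 2 ^ j := by positivity
  rw [tsum_int_eq_tsum_sum_range (2 ^ j), ← ENNReal.tsum_mul_left]
  refine ENNReal.tsum_le_tsum fun h => ?_
  have hterm : ∀ r ∈ Finset.range (2 ^ j),
      (if 2 ^ j < (h * ((2 ^ j : ℕ) : ℤ) + r) % 2 ^ j + 2 ^ k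
        then G ((h * ((2 ^ j : ℕ) : ℤ) + r) / 2 ^ j) else 0)
      = if 2 ^ j < r + 2 ^ k then G h else 0 := by
    intro r hr
    have hr' : (r : ℤ) < 2 ^ j := by exact_mod_cast Finset.mem_range.1 hr
    push_cast
    rw [add_comm (h * 2 ^ j), Int.add_mul_ediv_right _ _ hN.ne', Int.add_mul_emod_self_right,
      Int.ediv_eq_zero_of_lt (by positivity) hr', zero_add,
      Int.emod_eq_of_lt (by positivity) hr']
    congr 1
    norm_cast
  rw [Finset.sum_congr rfl hterm, ← Finset.sum_filter, Finset.sum_const, nsmul_eq_mul]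
  gcongr
  have hsub : (Finset.range (2 ^ j)).filter (fun r => 2 ^ j < r + 2 ^ k)
      ⊆ Finset.Ico (2 ^ j - 2 ^ k) (2 ^ j) := by
    intro r
    simp only [Finset.mem_filter, Finset.mem_range, Finset.mem_Ico]
    omega
  have hcard := Finset.card_le_card hsub
  rw [Nat.card_Ico, Nat.sub_sub_self (pow_le_pow_right₀ (by norm_num) hkj)] at hcard
  exact_mod_cast hcard

theorem tsum_avgSubExp_dyadicDiff_le_of_ge (hp : 2 ≤ p) {j k t : ℕ} (hkj : k ≤ j)
    (ht0 : 0 < t) (ht : t < 2 ^ k) (f : ℤ → B) :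
    ∑' x, ‖avgSubExp t k (dyadicDiff j f) x‖ₑ ^ p
      ≤ 2 ^ p * 2 ^ p * (2⁻¹ ^ (j - k) * dyadicDiffEnergy p j f) := by
  have hp0 : 0 < p := by linarith
  set U : ℤ → ℝ≥0∞ := fun h => ‖dyadicHalfDiff j f h‖ₑ ^ p
  set G : ℤ → ℝ≥0∞ := fun h => 2 ^ p * (2 ^ (p - 1) * (U (h / 2) + U ((h + 1) / 2)))
  have hpt : ∀ x : ℤ, ‖avgSubExp t k (dyadicDiff j f) x‖ₑ ^ p
      ≤ if 2 ^ j < x % 2 ^ j + 2 ^ k then G (x / 2 ^ j) else 0 := fun x => by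
    refine (ENNReal.rpow_le_rpow
      (enorm_avgSubExp_dyadicDiff_le_of_ge hkj ht0 ht f x) hp0.le).trans ?_
    split_ifs
    · rw [ENNReal.mul_rpow_of_nonneg _ _ hp0.le]
      exact mul_le_mul_right (ENNReal.rpow_add_le_mul_rpow_add_rpow _ _ (by linarith)) _
    · rw [ENNReal.zero_rpow_of_pos hp0]
  refine ((ENNReal.tsum_le_tsum hpt).trans (tsum_ite_emod_le hkj G)).trans_eq ?_
  have htwo : ∑' h : ℤ, U (h / 2) = 2 * ∑' h, U h := tsum_int_ediv 2 U
  have hpow : (2 : ℝ≥0∞) ^ k = 2⁻¹ ^ (j - k) * 2 ^ j := by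
    obtain ⟨m, rfl⟩ := Nat.exists_eq_add_of_le hkj
    rw [Nat.add_sub_cancel_left, pow_add, mul_left_comm, ← mul_pow,
      ENNReal.inv_mul_cancel (by simp) (by simp), one_pow, mul_one]
  rw [ENNReal.tsum_mul_left, ENNReal.tsum_mul_left, ENNReal.tsum_add,
    tsum_int_add_right 1 (fun h => U (h / 2)), htwo, dyadicDiffEnergy, hpow,
    ← two_rpow_sub_one_mul_two p, pow_succ]
  ring

/-- Almost orthogonality of the operators `avgSubExp` and the dyadic martingale differences. -/
theorem tsum_avgSubExp_dyadicDiff_le (hp : 2 ≤ p) {k t : ℕ} (ht : 2 ^ k ≤ t)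
    (ht' : t < 2 ^ (k + 1)) (f : ℤ → B) (j : ℕ) :
    ∑' x, ‖avgSubExp t (k + 1) (dyadicDiff j f) x‖ₑ ^ p
      ≤ 2 ^ p * 2 ^ p * (2⁻¹ ^ ((j : ℤ) - (k + 1 : ℕ)).natAbs * dyadicDiffEnergy p j f) := by
  rcases Nat.lt_or_ge j (k + 1) with h | h
  · refine (tsum_avgSubExp_dyadicDiff_le_of_le hp (Nat.le_of_lt_succ h) ht f).trans ?_
    have h2 : (2 : ℝ≥0∞) ≤ 2 ^ p := by
      simpa using ENNReal.rpow_le_rpow_of_exponent_le (by norm_num : (1 : ℝ≥0∞) ≤ 2)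
        (by linarith : 1 ≤ p)
    have hexp : ((j : ℤ) - (k + 1 : ℕ)).natAbs = (k - j) + 1 := by omega
    rw [hexp, mul_assoc, pow_succ]
    refine mul_le_mul_right ?_ _
    calc (2⁻¹ : ℝ≥0∞) ^ (k - j) * dyadicDiffEnergy p j f
        = 2 * (2⁻¹ ^ (k - j) * 2⁻¹ * dyadicDiffEnergy p j f) := by
          rw [mul_right_comm, mul_comm _ (2⁻¹ : ℝ≥0∞),
            ENNReal.mul_inv_cancel_left (by simp) (by simp)]
      _ ≤ _ := by gcongr
  · have hexp : ((j : ℤ) - (k + 1 : ℕ)).natAbs = j - (k + 1) := by omega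
    rw [hexp]
    exact tsum_avgSubExp_dyadicDiff_le_of_ge hp h (lt_of_lt_of_le (by positivity) ht) ht' f

end

theorem tsum_int_pow_natAbs_ne_top {r : ℝ} (h0 : 0 ≤ r) (h1 : r < 1) :
    ∑' n : ℤ, ENNReal.ofReal r ^ n.natAbs ≠ ⊤ := by
  have hs : Summable fun n : ℤ => r ^ n.natAbs := by
    refine Summable.of_nat_of_neg ?_ ?_ <;>
      simpa using summable_geometric_of_lt_one h0 h1
  simp_rw [← ENNReal.ofReal_pow h0]
  exact hs.tsum_ofReal_ne_top

theorem tsum_natAbs_sub_le (F : ℕ → ℝ≥0∞) (k : ℤ) :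
    ∑' j : ℕ, F ((j : ℤ) - k).natAbs ≤ ∑' n : ℤ, F n.natAbs :=
  ENNReal.tsum_comp_le_tsum_of_injective (f := fun j : ℕ => (j : ℤ) - k)
    (fun a b h => by simpa using h) (fun n => F n.natAbs)

/-- A weighted form of the Hölder inequality for sums. -/
theorem rpow_tsum_le_weight {p : ℝ} (hp : 1 ≤ p) (w g : ℕ → ℝ≥0∞) (hw0 : ∀ j, w j ≠ 0)
    (hw1 : ∀ j, w j ≤ 1) :
    (∑' j, g j) ^ p ≤ (∑' j, w j) ^ (p - 1) * ∑' j, (w j)⁻¹ ^ p * g j ^ p := by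
  have hp0 : 0 < p := by linarith
  have hpi : p⁻¹ ≤ 1 := inv_le_one_of_one_le₀ hp
  rw [← ENNReal.le_rpow_inv_iff hp0]
  refine ENNReal.tsum_le_of_sum_range_le fun N => ?_
  have h := ENNReal.inner_le_weight_mul_Lp_of_nonneg (Finset.range N) hp w
    fun j => (w j)⁻¹ * g j
  have hcancel : ∀ j, w j * ((w j)⁻¹ * g j) = g j := fun j =>
    ENNReal.mul_inv_cancel_left (hw0 j) (ne_top_of_le_ne_top (by simp) (hw1 j))
  simp only [hcancel] at h
  refine h.trans ?_
  rw [ENNReal.mul_rpow_of_nonneg _ _ (by positivity), ← ENNReal.rpow_mul,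
    show (p - 1) * p⁻¹ = 1 - p⁻¹ by field_simp]
  gcongr
  · exact ENNReal.sum_le_tsum _
  · refine le_trans (Finset.sum_le_sum fun j _ => ?_) (ENNReal.sum_le_tsum _)
    rw [ENNReal.mul_rpow_of_nonneg _ _ hp0.le]
    exact mul_le_of_le_one_left zero_le (hw1 j)

section
variable {B : Type*} [NormedAddCommGroup B] [NormedSpace ℝ B] {p K : ℝ}

/-- The sum over `ℤ` of the weights `2 ^ (-a * |n|)`. -/
noncomputable def weightSum (a : ℝ) : ℝ≥0∞ := ∑' n : ℤ, ENNReal.ofReal (2 ^ (-a)) ^ n.natAbs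

theorem weightSum_ne_top {a : ℝ} (ha : 0 < a) : weightSum a ≠ ⊤ :=
  tsum_int_pow_natAbs_ne_top (by positivity)
    (Real.rpow_lt_one_of_one_lt_of_neg (by norm_num) (by linarith))

theorem ofReal_weight_mul {p : ℝ} (hp : 0 < p) (n : ℕ) :
    (ENNReal.ofReal (2 ^ (-(1 / (2 * p)))) ^ n)⁻¹ ^ p * 2⁻¹ ^ n
      = ENNReal.ofReal (2 ^ (-(1 / 2 : ℝ))) ^ n := by
  have h2 : ∀ a : ℝ, ENNReal.ofReal (2 ^ a) = 2 ^ a := fun a => by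
    rw [← ENNReal.ofReal_rpow_of_pos (by norm_num), ENNReal.ofReal_ofNat]
  have hinv : (2⁻¹ : ℝ≥0∞) = 2 ^ (-1 : ℝ) := (ENNReal.rpow_neg_one 2).symm
  rw [h2, h2, hinv]
  simp only [← ENNReal.rpow_natCast, ← ENNReal.rpow_mul, ← ENNReal.rpow_neg]
  rw [← ENNReal.rpow_add _ _ two_ne_zero ENNReal.ofNat_ne_top]
  congr 1
  field_simp
  ring

theorem tsum_avgSubExp_le (hp : 2 ≤ p) (hK : 0 < K) (hB : HasPowerConvexity B p K)
    {f : ℤ → B} (hf : ∑' x, ‖f x‖ₑ ^ p ≠ ⊤) {k t : ℕ} (ht : 2 ^ k ≤ t) (ht' : t < 2 ^ (k + 1)) :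
    ∑' x, ‖avgSubExp t (k + 1) f x‖ₑ ^ p
      ≤ weightSum (1 / (2 * p)) ^ (p - 1) * (2 ^ p * 2 ^ p) * ∑' j : ℕ,
        ENNReal.ofReal (2 ^ (-(1 / 2 : ℝ))) ^ ((j : ℤ) - (k + 1 : ℕ)).natAbs
          * dyadicDiffEnergy p j f := by
  have hp0 : 0 < p := by linarith
  set r := ENNReal.ofReal (2 ^ (-(1 / (2 * p)))) with hr
  have hr0 : r ≠ 0 := by
    rw [hr, Ne, ENNReal.ofReal_eq_zero, not_le]
    positivity
  have hr1 : r ≤ 1 := by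
    rw [hr, ENNReal.ofReal_le_one]
    exact Real.rpow_le_one_of_one_le_of_nonpos (by norm_num)
      (neg_nonpos.2 (by positivity))
  set w : ℕ → ℝ≥0∞ := fun j => r ^ ((j : ℤ) - (k + 1 : ℕ)).natAbs
  have hpt : ∀ x, ‖avgSubExp t (k + 1) f x‖ₑ ^ p ≤ weightSum (1 / (2 * p)) ^ (p - 1) *
      ∑' j, (w j)⁻¹ ^ p * ‖avgSubExp t (k + 1) (dyadicDiff j f) x‖ₑ ^ p := fun x => by
    refine (ENNReal.rpow_le_rpow
      (enorm_avgSubExp_le_tsum hp hK hB hf t (k + 1) x) hp0.le).trans ?_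
    refine (rpow_tsum_le_weight (by linarith) w _ (fun j => pow_ne_zero _ hr0)
      fun j => pow_le_one' hr1 _).trans ?_
    exact mul_le_mul_left
      (ENNReal.rpow_le_rpow (tsum_natAbs_sub_le (fun n => r ^ n) _) (by linarith)) _
  refine (ENNReal.tsum_le_tsum hpt).trans ?_
  rw [ENNReal.tsum_mul_left, ENNReal.tsum_comm, mul_assoc,
    ← ENNReal.tsum_mul_left (a := 2 ^ p * 2 ^ p)]
  refine mul_le_mul_right (ENNReal.tsum_le_tsum fun j => ?_) _
  rw [ENNReal.tsum_mul_left, ← ofReal_weight_mul hp0]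
  refine (mul_le_mul_right (tsum_avgSubExp_dyadicDiff_le hp ht ht' f j) _).trans_eq ?_
  ring

theorem tsum_tsum_avgSubExp_le (hp : 2 ≤ p) (hK : 0 < K) (hB : HasPowerConvexity B p K)
    {f : ℤ → B} (hf : ∑' x, ‖f x‖ₑ ^ p ≠ ⊤) {t : ℕ → ℕ}
    (ht : ∀ k : ℕ, 2 ^ k ≤ t (k + 1) ∧ t (k + 1) < 2 ^ (k + 1)) :
    ∑' k : ℕ, ∑' x, ‖avgSubExp (t (k + 1)) (k + 1) f x‖ₑ ^ p
      ≤ weightSum (1 / (2 * p)) ^ (p - 1) * (2 ^ p * 2 ^ p) * weightSum (1 / 2)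
        * (ENNReal.ofReal (cotypeConst p K))⁻¹ * ∑' x, ‖f x‖ₑ ^ p := by
  have hc : ENNReal.ofReal (cotypeConst p K) ≠ 0 := by
    rw [Ne, ENNReal.ofReal_eq_zero, not_le]
    exact cotypeConst_pos hK
  refine (ENNReal.tsum_le_tsum fun k => tsum_avgSubExp_le hp hK hB hf (ht k).1 (ht k).2).trans ?_
  rw [ENNReal.tsum_mul_left, ENNReal.tsum_comm, mul_assoc (_ * (2 ^ p * 2 ^ p)), mul_assoc (_ * _)]
  refine mul_le_mul_right ?_ _
  calc ∑' (j : ℕ) (k : ℕ), ENNReal.ofReal (2 ^ (-(1 / 2 : ℝ))) ^ ((j : ℤ) - (k + 1 : ℕ)).natAbs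
          * dyadicDiffEnergy p j f
      ≤ ∑' j : ℕ, weightSum (1 / 2) * dyadicDiffEnergy p j f := by
        refine ENNReal.tsum_le_tsum fun j => ?_
        rw [ENNReal.tsum_mul_right]
        refine mul_le_mul_left ?_ _
        refine le_trans (le_of_eq (tsum_congr fun k => ?_)) (tsum_natAbs_sub_le
          (fun n => ENNReal.ofReal (2 ^ (-(1 / 2 : ℝ))) ^ n) ((j : ℤ) - 1))
        congr 1
        omega
    _ = weightSum (1 / 2) * ∑' j : ℕ, dyadicDiffEnergy p j f := ENNReal.tsum_mul_left
    _ ≤ weightSum (1 / 2) * ((ENNReal.ofReal (cotypeConst p K))⁻¹ * ∑' x, ‖f x‖ₑ ^ p) := by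
        gcongr
        rw [← ENNReal.div_eq_inv_mul, ENNReal.le_div_iff_mul_le (Or.inl hc) (by simp), mul_comm]
        exact mul_tsum_dyadicDiffEnergy_le hp hK hB f
    _ = _ := (mul_assoc _ _ _).symm

end

/-- For `p ≥ 2`, `K > 0` there is `C > 0` depending only on `p` and `K` such that for every real
Banach space `B` with modulus of uniform convexity `η(ε) = K ε^p`, every `f ∈ ℓ^p(B)` and every
sequence `(t k)_{k ≥ 1}` of positive integers with `t k ∈ [2^{k-1}, 2^k)` for `k ≥ 1`
(here indexed so that `t (k+1)` plays the role of `t_{k+1}`, `k+1 ≥ 1`),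
`∑_{k ≥ 1} ‖A_{t k} f − ℰ_k f‖_{ℓ^p(B)}^p ≤ C ‖f‖_{ℓ^p(B)}^p`
(the `p`-th powers of `ℓ^p(B)` norms written out as sums over `ℤ`, in `ℝ≥0∞`). -/
theorem stmt7 (p K : ℝ) (hp : 2 ≤ p) (hK : 0 < K) :
    ∃ C : ℝ, 0 < C ∧
      ∀ (B : Type*) [NormedAddCommGroup B] [NormedSpace ℝ B] [CompleteSpace B],
        (∀ ε ∈ Set.Ioc (0 : ℝ) 2, ∀ x y : B, ‖x‖ ≤ 1 → ‖y‖ ≤ 1 → ε ≤ ‖x - y‖ →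
          ‖(1 / 2 : ℝ) • (x + y)‖ ≤ 1 - K * ε ^ p) →
        ∀ f : ℤ → B, Memℓp f (ENNReal.ofReal p) →
        ∀ t : ℕ → ℕ, (∀ k : ℕ, 2 ^ k ≤ t (k + 1) ∧ t (k + 1) < 2 ^ (k + 1)) →
          ∑' k : ℕ, ∑' x : ℤ,
              (‖shiftAvg (t (k + 1)) f x - dyadicExp (k + 1) f x‖₊ : ℝ≥0∞) ^ p
            ≤ ENNReal.ofReal C * ∑' x : ℤ, (‖f x‖₊ : ℝ≥0∞) ^ p := by
  have hp0 : 0 < p := by linarith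
  set E : ℝ≥0∞ := weightSum (1 / (2 * p)) ^ (p - 1) * (2 ^ p * 2 ^ p) * weightSum (1 / 2)
    * (ENNReal.ofReal (cotypeConst p K))⁻¹ with hE
  have hE_top : E ≠ ⊤ := by
    have hc : (ENNReal.ofReal (cotypeConst p K))⁻¹ ≠ ⊤ := by
      rw [ENNReal.inv_ne_top, Ne, ENNReal.ofReal_eq_zero, not_le]
      exact cotypeConst_pos hK
    have h2 : (2 : ℝ≥0∞) ^ p ≠ ⊤ := ENNReal.rpow_ne_top_of_nonneg hp0.le ENNReal.ofNat_ne_top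
    have hw := ENNReal.rpow_ne_top_of_nonneg (by linarith : 0 ≤ p - 1)
      (weightSum_ne_top (by positivity : 0 < 1 / (2 * p)))
    exact ENNReal.mul_ne_top (ENNReal.mul_ne_top (ENNReal.mul_ne_top hw (ENNReal.mul_ne_top h2 h2))
      (weightSum_ne_top (by norm_num))) hc
  refine ⟨E.toReal + 1, by positivity, fun B _ _ _ hB f _ t ht => ?_⟩
  change ∑' k : ℕ, ∑' x : ℤ, ‖avgSubExp (t (k + 1)) (k + 1) f x‖ₑ ^ p
    ≤ ENNReal.ofReal (E.toReal + 1) * ∑' x : ℤ, ‖f x‖ₑ ^ p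
  by_cases hf : ∑' x : ℤ, ‖f x‖ₑ ^ p = ⊤
  · rw [hf, ENNReal.mul_top]
    · exact le_top
    · rw [Ne, ENNReal.ofReal_eq_zero, not_le]
      positivity
  · refine (tsum_tsum_avgSubExp_le hp hK hB hf ht).trans ?_
    gcongr
    rw [← hE, ← ENNReal.ofReal_toReal hE_top]
    exact ENNReal.ofReal_le_ofReal (by simp)
end

section
/- Let p ≥ 2 and K > 0. There exists a constant C > 0, depending only on p and K, such that for every real Banach space B with modulus of uniform convexity η(ε) = K ε^p, every f ∈ ℓ^p(B), and every strictly increasing sequence (t_i)_{i∈ℕ} of positive integers, one has ∑_k ∑_{i ∈ S_k} ‖A_{t_{i+1}} f − A_{t_i} f‖_{ℓ^p(B)}^p ≤ C ‖f‖_{ℓ^p(B)}^p, where S_k = { i : t_i ∈ [2^{k−1}, 2^k] and t_{i+1} ∈ [2^{k−1}, 2^k] }. -/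
open Finset ENNReal NNReal

/-- The scalar Clarkson inequality. -/
lemma half_add_rpow_add_half_sub_rpow_le {p u v : ℝ} (hp : 2 ≤ p) (hv : 0 ≤ v) (huv : v ≤ u) :
    ((u + v) / 2) ^ p + ((u - v) / 2) ^ p ≤ (u ^ p + v ^ p) / 2 := by
  have hu : 0 ≤ u := hv.trans huv
  have hsq : ∀ x : ℝ, 0 ≤ x → x ^ p = (x ^ 2) ^ (p / 2) := fun x hx => by
    rw [← Real.rpow_natCast_mul hx]
    congr 1
    push_cast
    ring
  have hp2 : 1 ≤ p / 2 := by linarith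
  calc ((u + v) / 2) ^ p + ((u - v) / 2) ^ p
      = (((u + v) / 2) ^ 2) ^ (p / 2) + (((u - v) / 2) ^ 2) ^ (p / 2) := by
        rw [hsq _ (by linarith), hsq ((u - v) / 2) (by linarith)]
    _ ≤ (((u + v) / 2) ^ 2 + ((u - v) / 2) ^ 2) ^ (p / 2) :=
        Real.add_rpow_le_rpow_add (sq_nonneg _) (sq_nonneg _) hp2
    _ = ((1 / 2) * u ^ 2 + (1 / 2) * v ^ 2) ^ (p / 2) := by ring_nf
    _ ≤ (1 / 2) * (u ^ 2) ^ (p / 2) + (1 / 2) * (v ^ 2) ^ (p / 2) :=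
        (convexOn_rpow hp2).2 (sq_nonneg u) (sq_nonneg v) (by norm_num) (by norm_num) (by norm_num)
    _ = (u ^ p + v ^ p) / 2 := by rw [← hsq u hu, ← hsq v hv]; ring

/-- Uniform convexity with modulus `K ε ^ p` implies the `p`-uniform convexity inequality. -/
lemma norm_half_add_rpow_le {B : Type*} [NormedAddCommGroup B] [NormedSpace ℝ B] {p K : ℝ}
    (hp : 2 ≤ p) (hK : 0 < K)
    (hB : ∀ ε ∈ Set.Ioc (0 : ℝ) 2, ∀ x y : B, ‖x‖ ≤ 1 → ‖y‖ ≤ 1 → ε ≤ ‖x - y‖ →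
      ‖(1 / 2 : ℝ) • (x + y)‖ ≤ 1 - K * ε ^ p) (x y : B) :
    ‖(1 / 2 : ℝ) • (x + y)‖ ^ p + min ((1 / 8) ^ p) (K * (1 / 4) ^ p) * ‖x - y‖ ^ p
      ≤ (‖x‖ ^ p + ‖y‖ ^ p) / 2 := by
  wlog hxy : ‖y‖ ≤ ‖x‖ generalizing x y
  · have := this y x (le_of_not_ge hxy)
    rwa [add_comm y x, norm_sub_rev, add_comm (‖y‖ ^ p)] at this
  have hp0 : 0 ≤ p := by linarith
  set u := ‖x‖ with hu
  set v := ‖y‖ with hv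
  set e := ‖x - y‖ with he
  have hv0 : 0 ≤ v := norm_nonneg y
  have he0 : 0 ≤ e := norm_nonneg _
  have heu : e ≤ 2 * u := (norm_sub_le x y).trans (by linarith)
  have hclark := half_add_rpow_add_half_sub_rpow_le hp hv0 hxy
  have hmid : ‖(1 / 2 : ℝ) • (x + y)‖ ≤ (u + v) / 2 := by
    rw [norm_smul, Real.norm_of_nonneg (by norm_num)]
    linarith [norm_add_le x y]
  rcases le_or_gt (e / 4) (u - v) with hcase | hcase
  · have h1 : ‖(1 / 2 : ℝ) • (x + y)‖ ^ p ≤ ((u + v) / 2) ^ p :=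
      Real.rpow_le_rpow (norm_nonneg _) hmid hp0
    have h2 : (1 / 8 : ℝ) ^ p * e ^ p ≤ ((u - v) / 2) ^ p := by
      rw [← Real.mul_rpow (by norm_num) he0]
      exact Real.rpow_le_rpow (by positivity) (by linarith) hp0
    have h3 := mul_le_mul_of_nonneg_right
      (min_le_left ((1 / 8 : ℝ) ^ p) (K * (1 / 4) ^ p)) (Real.rpow_nonneg he0 p)
    linarith
  · have hepos : 0 < e := by linarith
    have hupos : 0 < u := by linarith
    have hvu : u / 2 ≤ v := by linarith
    have hvpos : 0 < v := by linarith
    have hxn : ‖u⁻¹ • x‖ ≤ 1 := by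
      rw [norm_smul, Real.norm_of_nonneg (by positivity), ← hu, inv_mul_cancel₀ hupos.ne']
    have hyn : ‖v⁻¹ • y‖ = 1 := by
      rw [norm_smul, Real.norm_of_nonneg (by positivity), ← hv, inv_mul_cancel₀ hvpos.ne']
    have hdist : e / (2 * u) ≤ ‖u⁻¹ • x - v⁻¹ • y‖ := by
      have h1 : x - y = u • (u⁻¹ • x - v⁻¹ • y) + (u - v) • (v⁻¹ • y) := by
        rw [smul_sub, smul_inv_smul₀ hupos.ne', sub_smul, smul_inv_smul₀ hvpos.ne']
        abel
      have h2 : e ≤ u * ‖u⁻¹ • x - v⁻¹ • y‖ + (u - v) := by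
        rw [he, h1]
        refine (norm_add_le _ _).trans ?_
        rw [norm_smul, norm_smul (u - v), hyn, Real.norm_of_nonneg hupos.le,
          Real.norm_of_nonneg (sub_nonneg.2 hxy), mul_one]
      rw [div_le_iff₀ (by positivity)]
      linarith
    have hconv := hB (e / (2 * u)) ⟨by positivity, by
      rw [div_le_iff₀ (by positivity)]; linarith⟩ _ _ hxn hyn.le hdist
    set d := v * (K * (e / (2 * u)) ^ p) with hd
    have hle : ‖(1 / 2 : ℝ) • (x + y)‖ ≤ (u + v) / 2 - d := by
      have h1 : (1 / 2 : ℝ) • (x + y)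
          = v • ((1 / 2 : ℝ) • (u⁻¹ • x + v⁻¹ • y)) + ((u - v) / 2) • (u⁻¹ • x) := by
        simp only [smul_add, smul_smul]
        rw [add_right_comm, ← add_smul]
        congr 2 <;> field_simp
        ring
      rw [h1]
      refine (norm_add_le _ _).trans ?_
      rw [norm_smul, norm_smul ((u - v) / 2), Real.norm_of_nonneg hv0,
        Real.norm_of_nonneg (by linarith)]
      have h2 := mul_le_mul_of_nonneg_left hconv hv0
      have h3 := mul_le_mul_of_nonneg_left hxn (by linarith : 0 ≤ (u - v) / 2)
      rw [hd]
      linarith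
    have hpow : ∀ z : ℝ, 0 ≤ z → z ^ p = z ^ (p - 1) * z := fun z hz => by
      rw [← Real.rpow_add_one' hz (by linarith), sub_add_cancel]
    have hm0 : 0 ≤ (u + v) / 2 := by linarith
    have h1 : ‖(1 / 2 : ℝ) • (x + y)‖ ^ p
        ≤ ((u + v) / 2) ^ p - ((u + v) / 2) ^ (p - 1) * d := by
      rw [hpow _ (norm_nonneg _), hpow _ hm0, ← mul_sub]
      exact mul_le_mul (Real.rpow_le_rpow (norm_nonneg _) hmid (by linarith)) hle
        (norm_nonneg _) (Real.rpow_nonneg hm0 _)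
    have h2 : K * (1 / 4) ^ p * e ^ p ≤ ((u + v) / 2) ^ (p - 1) * d := by
      have h3 : (1 / 4 : ℝ) ^ p * e ^ p = (u / 2) ^ (p - 1) * (u / 2) * (e / (2 * u)) ^ p := by
        rw [← hpow _ (by positivity), ← Real.mul_rpow (by norm_num) he0,
          ← Real.mul_rpow (by positivity) (by positivity)]
        congr 1
        field_simp
        ring
      rw [mul_assoc, h3, hd]
      have h4 : (u / 2) ^ (p - 1) * (u / 2) ≤ ((u + v) / 2) ^ (p - 1) * v :=
        mul_le_mul (Real.rpow_le_rpow (by positivity) (by linarith) (by linarith)) hvu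
          (by positivity) (Real.rpow_nonneg hm0 _)
      have h5 := mul_le_mul_of_nonneg_right h4
        (by positivity : 0 ≤ K * (e / (2 * u)) ^ p)
      linarith
    have h3 := mul_le_mul_of_nonneg_right
      (min_le_right ((1 / 8 : ℝ) ^ p) (K * (1 / 4) ^ p)) (Real.rpow_nonneg he0 p)
    have h4 : 0 ≤ ((u - v) / 2) ^ p := Real.rpow_nonneg (by linarith) p
    linarith

section Orbit

variable {X : Type*} [NormedAddCommGroup X] [NormedSpace ℝ X]

/-- The sum of the first `n` points of the orbit of `f` under `T`. -/
def orbitSum (T : X →ₗ[ℝ] X) (f : X) (n : ℕ) : X :=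
  ∑ i ∈ Finset.range n, (T ^ i) f

/-- The ergodic average of `f` under `T` of length `2 ^ l`. -/
noncomputable def dyadicAvg (T : X →ₗ[ℝ] X) (f : X) (l : ℕ) : X :=
  ((2 : ℝ) ^ l)⁻¹ • orbitSum T f (2 ^ l)

/-- The distance between two consecutive ergodic averages of length `2 ^ l`. -/
noncomputable def dyadicGap (T : X →ₗ[ℝ] X) (f : X) (l : ℕ) : ℝ :=
  ‖dyadicAvg T f l - (T ^ (2 ^ l)) (dyadicAvg T f l)‖

lemma dyadicGap_nonneg (T : X →ₗ[ℝ] X) (f : X) (l : ℕ) : 0 ≤ dyadicGap T f l :=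
  norm_nonneg _

lemma orbitSum_add (T : X →ₗ[ℝ] X) (f : X) (a n : ℕ) :
    orbitSum T f (a + n) = orbitSum T f a + (T ^ a) (orbitSum T f n) := by
  simp [orbitSum, Finset.sum_range_add, pow_add, map_sum]

lemma norm_pow_apply_le {T : X →ₗ[ℝ] X} (hT : ∀ x, ‖T x‖ ≤ ‖x‖) (n : ℕ) (x : X) :
    ‖(T ^ n) x‖ ≤ ‖x‖ := by
  induction n with
  | zero => simp
  | succ n ih => rw [pow_succ']; exact (hT _).trans ih

lemma two_pow_smul_dyadicAvg (T : X →ₗ[ℝ] X) (f : X) (l : ℕ) :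
    ((2 : ℝ) ^ l) • dyadicAvg T f l = orbitSum T f (2 ^ l) :=
  smul_inv_smul₀ (by positivity) _

lemma dyadicAvg_succ (T : X →ₗ[ℝ] X) (f : X) (l : ℕ) :
    dyadicAvg T f (l + 1)
      = (1 / 2 : ℝ) • (dyadicAvg T f l + (T ^ (2 ^ l)) (dyadicAvg T f l)) := by
  rw [dyadicAvg, pow_succ (2 : ℕ) l, mul_two, orbitSum_add, dyadicAvg, map_smul, ← smul_add, smul_smul]
  congr 1
  rw [pow_succ]
  field_simp

lemma norm_dyadicAvg_sub_succ (T : X →ₗ[ℝ] X) (f : X) (l : ℕ) :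
    ‖dyadicAvg T f l - dyadicAvg T f (l + 1)‖ = dyadicGap T f l / 2 := by
  have h : dyadicAvg T f l - dyadicAvg T f (l + 1)
      = (1 / 2 : ℝ) • (dyadicAvg T f l - (T ^ (2 ^ l)) (dyadicAvg T f l)) := by
    rw [dyadicAvg_succ]
    module
  rw [h, norm_smul, Real.norm_of_nonneg (by norm_num), dyadicGap]
  ring

/-- Each orbit sum is close to the corresponding multiple of a longer dyadic average. -/
lemma norm_orbitSum_sub_smul_dyadicAvg_le {T : X →ₗ[ℝ] X} (hT : ∀ x, ‖T x‖ ≤ ‖x‖) (f : X)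
    (j n : ℕ) (hn : n ≤ 2 ^ j) :
    ‖orbitSum T f n - (n : ℝ) • dyadicAvg T f j‖
      ≤ 2 * ∑ l ∈ Finset.range j, min ((2 : ℝ) ^ l) n * dyadicGap T f l := by
  induction j generalizing n with
  | zero =>
    obtain rfl | rfl : n = 0 ∨ n = 1 := by simp at hn; omega
    · simp [orbitSum]
    · simp [orbitSum, dyadicAvg]
  | succ j ih =>
    have he := dyadicGap_nonneg T f j
    have hstep : ‖orbitSum T f n - (n : ℝ) • dyadicAvg T f (j + 1)‖
        ≤ ‖orbitSum T f n - (n : ℝ) • dyadicAvg T f j‖ + n * (dyadicGap T f j / 2) := by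
      rw [← norm_dyadicAvg_sub_succ]
      calc _ = ‖(orbitSum T f n - (n : ℝ) • dyadicAvg T f j)
              + (n : ℝ) • (dyadicAvg T f j - dyadicAvg T f (j + 1))‖ := by congr 1; module
        _ ≤ _ := (norm_add_le _ _).trans (by rw [norm_smul, Real.norm_natCast])
    rw [Finset.sum_range_succ, mul_add]
    rcases le_total n (2 ^ j) with h | h
    · have h' : (n : ℝ) ≤ 2 ^ j := by exact_mod_cast h
      have := ih n h
      rw [min_eq_right h']
      have : 0 ≤ (n : ℝ) * dyadicGap T f j := by positivity
      linarith
    · obtain ⟨m, rfl⟩ := Nat.exists_eq_add_of_le h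
      have hm : m ≤ 2 ^ j := by rw [pow_succ] at hn; omega
      have hm' : (m : ℝ) ≤ 2 ^ j := by exact_mod_cast hm
      have hsplit : orbitSum T f (2 ^ j + m) - ((2 ^ j + m : ℕ) : ℝ) • dyadicAvg T f j
          = (T ^ (2 ^ j)) (orbitSum T f m - (m : ℝ) • dyadicAvg T f j)
            - (m : ℝ) • (dyadicAvg T f j - (T ^ (2 ^ j)) (dyadicAvg T f j)) := by
        rw [orbitSum_add, ← two_pow_smul_dyadicAvg, map_sub, map_smul]
        push_cast
        module
      have hbound : ‖orbitSum T f (2 ^ j + m) - ((2 ^ j + m : ℕ) : ℝ) • dyadicAvg T f j‖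
          ≤ ‖orbitSum T f m - (m : ℝ) • dyadicAvg T f j‖ + m * dyadicGap T f j := by
        rw [hsplit]
        refine (norm_sub_le _ _).trans (add_le_add (norm_pow_apply_le hT _ _) ?_)
        rw [norm_smul, Real.norm_natCast, dyadicGap]
      have hmono : ∑ l ∈ Finset.range j, min ((2 : ℝ) ^ l) m * dyadicGap T f l
          ≤ ∑ l ∈ Finset.range j, min ((2 : ℝ) ^ l) ((2 ^ j + m : ℕ) : ℝ) * dyadicGap T f l := by
        refine Finset.sum_le_sum fun l _ => mul_le_mul_of_nonneg_right
          (min_le_min le_rfl ?_) (dyadicGap_nonneg T f l)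
        exact_mod_cast Nat.le_add_left m (2 ^ j)
      have hmin : min ((2 : ℝ) ^ j) ((2 ^ j + m : ℕ) : ℝ) = 2 ^ j :=
        min_eq_left (by push_cast; linarith [m.cast_nonneg (α := ℝ)])
      rw [hmin]
      have hih := ih m hm
      have h1 := mul_le_mul_of_nonneg_right hm' he
      have h2 : ((2 ^ j + m : ℕ) : ℝ) * (dyadicGap T f j / 2) ≤ 2 ^ j * dyadicGap T f j := by
        push_cast
        linarith
      linarith

/-- Shifting a dyadic average by at most its length moves it little. -/
lemma norm_pow_apply_dyadicAvg_sub_le {T : X →ₗ[ℝ] X} (hT : ∀ x, ‖T x‖ ≤ ‖x‖) (f : X)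
    (j b : ℕ) (hb : b ≤ 2 ^ j) :
    2 ^ j * ‖(T ^ b) (dyadicAvg T f j) - dyadicAvg T f j‖
      ≤ 4 * ∑ l ∈ Finset.range (j + 1), (2 : ℝ) ^ l * dyadicGap T f l := by
  have hb' : (b : ℝ) ≤ 2 ^ j := by exact_mod_cast hb
  have he := dyadicGap_nonneg T f j
  have hcomm : (2 : ℝ) ^ j • ((T ^ b) (dyadicAvg T f j) - dyadicAvg T f j)
      = (T ^ (2 ^ j)) (orbitSum T f b - (b : ℝ) • dyadicAvg T f j)
        - (orbitSum T f b - (b : ℝ) • dyadicAvg T f j)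
        - (b : ℝ) • (dyadicAvg T f j - (T ^ (2 ^ j)) (dyadicAvg T f j)) := by
    have h1 := orbitSum_add T f b (2 ^ j)
    rw [add_comm b, orbitSum_add, ← two_pow_smul_dyadicAvg, map_smul] at h1
    rw [map_sub, map_smul, smul_sub, eq_sub_of_add_eq' h1.symm]
    module
  have hR := norm_orbitSum_sub_smul_dyadicAvg_le hT f j b hb
  have hmono : ∑ l ∈ Finset.range j, min ((2 : ℝ) ^ l) b * dyadicGap T f l
      ≤ ∑ l ∈ Finset.range j, (2 : ℝ) ^ l * dyadicGap T f l :=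
    Finset.sum_le_sum fun l _ => mul_le_mul_of_nonneg_right (min_le_left _ _)
      (dyadicGap_nonneg T f l)
  have hnorm : 2 ^ j * ‖(T ^ b) (dyadicAvg T f j) - dyadicAvg T f j‖
      ≤ ‖orbitSum T f b - (b : ℝ) • dyadicAvg T f j‖
        + ‖orbitSum T f b - (b : ℝ) • dyadicAvg T f j‖ + b * dyadicGap T f j := by
    rw [← Real.norm_of_nonneg (by positivity : (0 : ℝ) ≤ 2 ^ j), ← norm_smul, hcomm]
    refine (norm_sub_le _ _).trans (add_le_add ((norm_sub_le _ _).trans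
      (add_le_add (norm_pow_apply_le hT _ _) le_rfl)) ?_)
    rw [norm_smul, Real.norm_natCast, dyadicGap]
  rw [Finset.sum_range_succ]
  have h1 := mul_le_mul_of_nonneg_right hb' he
  have h2 : 0 ≤ (2 : ℝ) ^ j * dyadicGap T f j := by positivity
  linarith

/-- Two ergodic averages whose lengths lie in the same dyadic block are close. -/
lemma norm_avg_add_sub_avg_le {T : X →ₗ[ℝ] X} (hT : ∀ x, ‖T x‖ ≤ ‖x‖) (f : X)
    (k t s : ℕ) (ht : 2 ^ k ≤ t) (hts : t + s ≤ 2 ^ (k + 1)) :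
    2 ^ k * ‖((t + s : ℕ) : ℝ)⁻¹ • orbitSum T f (t + s) - (t : ℝ)⁻¹ • orbitSum T f t‖
      ≤ 10 * ∑ l ∈ Finset.range (k + 2), min ((2 : ℝ) ^ l) s * dyadicGap T f l := by
  set h := dyadicAvg T f (k + 1) with hh
  set M := ∑ l ∈ Finset.range (k + 2), min ((2 : ℝ) ^ l) s * dyadicGap T f l with hM
  have he := dyadicGap_nonneg T f
  have ht' : (2 : ℝ) ^ k ≤ t := by exact_mod_cast ht
  have h2k : (0 : ℝ) < 2 ^ k := by positivity
  have htpos : (0 : ℝ) < t := h2k.trans_le ht'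
  have hs2 : s ≤ 2 ^ k := by rw [pow_succ] at hts; omega
  have hs' : (s : ℝ) ≤ 2 ^ k := by exact_mod_cast hs2
  have hs0 : (0 : ℝ) ≤ s := s.cast_nonneg
  have hextend : ∀ g : ℕ → ℝ, (∀ l, 0 ≤ g l) →
      ∑ l ∈ Finset.range (k + 1), g l ≤ ∑ l ∈ Finset.range (k + 2), g l := fun g hg =>
    Finset.sum_le_sum_of_subset_of_nonneg (Finset.range_mono (by omega)) fun l _ _ => hg l
  have hA : ‖orbitSum T f s - (s : ℝ) • h‖ ≤ 2 * M := by
    refine (norm_orbitSum_sub_smul_dyadicAvg_le hT f (k + 1) s (by rw [pow_succ]; omega)).trans ?_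
    have := hextend (fun l => min ((2 : ℝ) ^ l) s * dyadicGap T f l)
      fun l => mul_nonneg (le_min (by positivity) hs0) (he l)
    linarith
  have hS : (s : ℝ) * ‖(T ^ t) h - h‖ ≤ 4 * M := by
    have h1 := norm_pow_apply_dyadicAvg_sub_le hT f (k + 1) t (by omega)
    have h2 : (s : ℝ) / 2 ^ (k + 1)
          * ∑ l ∈ Finset.range (k + 2), (2 : ℝ) ^ l * dyadicGap T f l ≤ M := by
      rw [hM, Finset.mul_sum]
      refine Finset.sum_le_sum fun l hl => ?_
      rw [← mul_assoc]
      refine mul_le_mul_of_nonneg_right (le_min ?_ ?_) (he l)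
      · refine mul_le_of_le_one_left (by positivity) ?_
        rw [div_le_one (by positivity), pow_succ]
        linarith
      · rw [div_mul_eq_mul_div]
        refine div_le_of_le_mul₀ (by positivity) hs0 (mul_le_mul_of_nonneg_left ?_ hs0)
        exact pow_le_pow_right₀ (by norm_num) (by have := Finset.mem_range.1 hl; omega)
    calc (s : ℝ) * ‖(T ^ t) h - h‖
        = (s : ℝ) / 2 ^ (k + 1) * (2 ^ (k + 1) * ‖(T ^ t) h - h‖) := by field_simp
      _ ≤ (s : ℝ) / 2 ^ (k + 1) *
            (4 * ∑ l ∈ Finset.range (k + 2), (2 : ℝ) ^ l * dyadicGap T f l) :=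
          mul_le_mul_of_nonneg_left h1 (by positivity)
      _ ≤ 4 * M := by linarith
  have hB : (s : ℝ) / t * ‖orbitSum T f t - (t : ℝ) • h‖ ≤ 4 * M := by
    have h1 := norm_orbitSum_sub_smul_dyadicAvg_le hT f (k + 1) t (by omega)
    have h2 : (s : ℝ) / t
        * ∑ l ∈ Finset.range (k + 1), min ((2 : ℝ) ^ l) t * dyadicGap T f l ≤ 2 * M := by
      refine (mul_le_mul_of_nonneg_left (hextend _ fun l => mul_nonneg
        (le_min (by positivity) htpos.le) (he l)) (by positivity)).trans ?_
      rw [hM, Finset.mul_sum, Finset.mul_sum]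
      refine Finset.sum_le_sum fun l _ => ?_
      rw [← mul_assoc, ← mul_assoc]
      refine mul_le_mul_of_nonneg_right ?_ (he l)
      have h3 : (s : ℝ) / t * min ((2 : ℝ) ^ l) t ≤ min ((2 : ℝ) ^ l) s := by
        refine le_min ?_ ?_
        · exact (mul_le_of_le_one_left (le_min (by positivity) htpos.le)
            ((div_le_one htpos).2 (hs'.trans ht'))).trans (min_le_left _ _)
        · calc (s : ℝ) / t * min ((2 : ℝ) ^ l) t ≤ (s : ℝ) / t * t :=
                mul_le_mul_of_nonneg_left (min_le_right _ _) (by positivity)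
            _ = s := div_mul_cancel₀ _ htpos.ne'
      have h4 : 0 ≤ min ((2 : ℝ) ^ l) s := le_min (by positivity) hs0
      linarith
    have h3 := mul_le_mul_of_nonneg_left h1 (by positivity : 0 ≤ (s : ℝ) / t)
    linarith
  have hid : ((t + s : ℕ) : ℝ) •
        (((t + s : ℕ) : ℝ)⁻¹ • orbitSum T f (t + s) - (t : ℝ)⁻¹ • orbitSum T f t)
      = (T ^ t) (orbitSum T f s - (s : ℝ) • h) + (s : ℝ) • ((T ^ t) h - h)
        - ((s : ℝ) / t) • (orbitSum T f t - (t : ℝ) • h) := by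
    have hts0 : ((t + s : ℕ) : ℝ) ≠ 0 := by push_cast; positivity
    rw [smul_sub, smul_inv_smul₀ hts0, orbitSum_add, map_sub, map_smul, smul_sub ((s : ℝ) / t),
      smul_smul ((s : ℝ) / t), div_mul_cancel₀ _ htpos.ne', smul_smul]
    have h5 : ((t + s : ℕ) : ℝ) * (t : ℝ)⁻¹ = 1 + (s : ℝ) / t := by
      push_cast; field_simp
    rw [h5]
    module
  calc 2 ^ k * ‖((t + s : ℕ) : ℝ)⁻¹ • orbitSum T f (t + s) - (t : ℝ)⁻¹ • orbitSum T f t‖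
      ≤ ((t + s : ℕ) : ℝ) *
          ‖((t + s : ℕ) : ℝ)⁻¹ • orbitSum T f (t + s) - (t : ℝ)⁻¹ • orbitSum T f t‖ :=
        mul_le_mul_of_nonneg_right (by push_cast; linarith) (norm_nonneg _)
    _ = ‖(T ^ t) (orbitSum T f s - (s : ℝ) • h) + (s : ℝ) • ((T ^ t) h - h)
        - ((s : ℝ) / t) • (orbitSum T f t - (t : ℝ) • h)‖ := by
        rw [← hid, norm_smul, Real.norm_natCast]
    _ ≤ 2 * M + 4 * M + 4 * M := by
        refine (norm_sub_le _ _).trans (add_le_add ((norm_add_le _ _).trans (add_le_add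
          ((norm_pow_apply_le hT _ _).trans hA) ?_)) ?_)
        · rwa [norm_smul, Real.norm_natCast]
        · rwa [norm_smul, Real.norm_of_nonneg (by positivity)]
    _ = 10 * M := by ring

/-- The `p`-th powers of the dyadic gaps are summable, by telescoping. -/
lemma sum_dyadicGap_rpow_le {T : X →ₗ[ℝ] X} (hT : ∀ x, ‖T x‖ ≤ ‖x‖) {p δ : ℝ} (hp : 0 ≤ p)
    (hX : ∀ x y : X, ‖(1 / 2 : ℝ) • (x + y)‖ ^ p + δ * ‖x - y‖ ^ p ≤ (‖x‖ ^ p + ‖y‖ ^ p) / 2)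
    (f : X) (N : ℕ) :
    δ * ∑ l ∈ Finset.range N, dyadicGap T f l ^ p ≤ ‖f‖ ^ p := by
  have key : ‖dyadicAvg T f N‖ ^ p + δ * ∑ l ∈ Finset.range N, dyadicGap T f l ^ p
      ≤ ‖f‖ ^ p := by
    induction N with
    | zero => simp [dyadicAvg, orbitSum]
    | succ N ih =>
      have h1 := hX (dyadicAvg T f N) ((T ^ (2 ^ N)) (dyadicAvg T f N))
      rw [← dyadicAvg_succ] at h1
      have h2 := Real.rpow_le_rpow (norm_nonneg _)
        (norm_pow_apply_le hT (2 ^ N) (dyadicAvg T f N)) hp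
      rw [Finset.sum_range_succ, mul_add]
      simp only [dyadicGap] at ih ⊢
      linarith
  linarith [Real.rpow_nonneg (norm_nonneg (dyadicAvg T f N)) p]

end Orbit

/-- The convolution of `g` with a geometric sequence of ratio `r⁻¹`. -/
noncomputable def geomConv (r : ℝ) (g : ℕ → ℝ) (n : ℕ) : ℝ :=
  ∑ l ∈ Finset.range n, r ^ l / r ^ n * g l

lemma geomConv_nonneg {r : ℝ} (hr : 0 ≤ r) {g : ℕ → ℝ} (hg : ∀ l, 0 ≤ g l) (n : ℕ) :
    0 ≤ geomConv r g n :=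
  Finset.sum_nonneg fun l _ => mul_nonneg (by positivity) (hg l)

lemma mul_geomConv_succ {r : ℝ} (hr : r ≠ 0) (g : ℕ → ℝ) (n : ℕ) :
    r * geomConv r g (n + 1) = geomConv r g n + g n := by
  rw [geomConv, Finset.mul_sum, Finset.sum_range_succ, geomConv]
  congr 1
  · refine Finset.sum_congr rfl fun l _ => ?_
    rw [pow_succ]
    field_simp
  · rw [pow_succ]
    field_simp

lemma sum_geomConv_le {r : ℝ} (hr : 0 < r) {g : ℕ → ℝ} (hg : ∀ l, 0 ≤ g l) (N : ℕ) :
    (r - 1) * ∑ n ∈ Finset.range N, geomConv r g n ≤ ∑ n ∈ Finset.range N, g n := by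
  have key : (r - 1) * ∑ n ∈ Finset.range N, geomConv r g n + r * geomConv r g N
      = ∑ n ∈ Finset.range N, g n := by
    induction N with
    | zero => simp [geomConv]
    | succ N ih =>
      rw [Finset.sum_range_succ, Finset.sum_range_succ, mul_geomConv_succ hr.ne', ← ih]
      ring
  linarith [mul_nonneg hr.le (geomConv_nonneg hr.le hg N)]

lemma sum_geometric_weights_le {r : ℝ} (hr : 1 < r) (n : ℕ) :
    ∑ l ∈ Finset.range n, r ^ l / r ^ n ≤ (r - 1)⁻¹ := by
  have h0 : 0 < r - 1 := by linarith
  rw [← Finset.sum_div, geom_sum_eq hr.ne', div_div, div_le_iff₀ (by positivity)]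
  field_simp
  linarith

lemma geomConv_rpow_le {r p : ℝ} (hr : 1 < r) (hr2 : r ≤ 2) (hp : 1 ≤ p) {g : ℕ → ℝ}
    (hg : ∀ l, 0 ≤ g l) (n : ℕ) :
    geomConv r g n ^ p ≤ (r - 1)⁻¹ ^ p * geomConv r (fun l => g l ^ p) n := by
  have hr0 : 0 < r := by linarith
  have hp0 : 0 < p := by linarith
  have hc : 1 ≤ (r - 1)⁻¹ := (one_le_inv₀ (by linarith)).2 (by linarith)
  have hw0 : 0 ≤ ∑ l ∈ Finset.range n, r ^ l / r ^ n := Finset.sum_nonneg fun l _ => by positivity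
  have hV := geomConv_nonneg hr0.le (fun l => Real.rpow_nonneg (hg l) p) n
  have hexp : 0 ≤ 1 - p⁻¹ := sub_nonneg.2 (inv_le_one_of_one_le₀ hp)
  have hholder := Real.inner_le_weight_mul_Lp_of_nonneg (Finset.range n) hp
    (fun l => r ^ l / r ^ n) g (fun l => by positivity) hg
  have hweights : (∑ l ∈ Finset.range n, r ^ l / r ^ n) ^ (1 - p⁻¹) ≤ (r - 1)⁻¹ :=
    calc _ ≤ (r - 1)⁻¹ ^ (1 - p⁻¹) :=
          Real.rpow_le_rpow hw0 (sum_geometric_weights_le hr n) hexp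
      _ ≤ (r - 1)⁻¹ ^ (1 : ℝ) :=
          Real.rpow_le_rpow_of_exponent_le hc (by linarith [inv_pos.2 hp0])
      _ = (r - 1)⁻¹ := Real.rpow_one _
  have hle : geomConv r g n ≤ (r - 1)⁻¹ * geomConv r (fun l => g l ^ p) n ^ p⁻¹ :=
    hholder.trans (mul_le_mul_of_nonneg_right hweights (Real.rpow_nonneg hV _))
  refine (Real.rpow_le_rpow (geomConv_nonneg hr0.le hg n) hle hp0.le).trans_eq ?_
  rw [Real.mul_rpow (by positivity) (Real.rpow_nonneg hV _), Real.rpow_inv_rpow hV hp0.ne']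

section Orbit

variable {X : Type*} [NormedAddCommGroup X] [NormedSpace ℝ X]

lemma norm_avg_add_sub_avg_rpow_le {T : X →ₗ[ℝ] X} (hT : ∀ x, ‖T x‖ ≤ ‖x‖) (f : X)
    {p : ℝ} (hp : 2 ≤ p) (k t s : ℕ) (ht : 2 ^ k ≤ t) (hts : t + s ≤ 2 ^ (k + 1)) :
    ‖((t + s : ℕ) : ℝ)⁻¹ • orbitSum T f (t + s) - (t : ℝ)⁻¹ • orbitSum T f t‖ ^ p
      ≤ (20 * (√2 - 1)⁻¹) ^ p * geomConv √2 (fun l => dyadicGap T f l ^ p) (k + 2)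
        * (s / 2 ^ k) := by
  set D := ‖((t + s : ℕ) : ℝ)⁻¹ • orbitSum T f (t + s) - (t : ℝ)⁻¹ • orbitSum T f t‖ with hD
  have he := dyadicGap_nonneg T f
  have hr0 : (0 : ℝ) < √2 := by positivity
  have hr1 : (1 : ℝ) < √2 := Real.lt_sqrt_of_sq_lt (by norm_num)
  have hr2 : √2 ≤ (2 : ℝ) := by rw [Real.sqrt_le_left (by norm_num)]; norm_num
  have hrr : ∀ l : ℕ, (2 : ℝ) ^ l = √2 ^ l * √2 ^ l := fun l => by
    rw [← mul_pow, Real.mul_self_sqrt (by norm_num)]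
  have hs2 : s ≤ 2 ^ k := by rw [pow_succ] at hts; omega
  have hs' : (s : ℝ) ≤ 2 ^ k := by exact_mod_cast hs2
  have hs0 : (0 : ℝ) ≤ s := s.cast_nonneg
  have hσ1 : (s : ℝ) / 2 ^ k ≤ 1 := (div_le_one (by positivity)).2 hs'
  have hσ0 : 0 ≤ (s : ℝ) / 2 ^ k := by positivity
  have hmin : ∀ l : ℕ, min ((2 : ℝ) ^ l) s ≤ √s * √2 ^ l := fun l => by
    refine abs_le_of_sq_le_sq' ?_ (by positivity) |>.2
    have h0 : 0 ≤ min ((2 : ℝ) ^ l) s := le_min (by positivity) hs0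
    calc min ((2 : ℝ) ^ l) s ^ 2 = min ((2 : ℝ) ^ l) s * min ((2 : ℝ) ^ l) s := sq _
      _ ≤ s * 2 ^ l := mul_le_mul (min_le_right _ _) (min_le_left _ _) h0 hs0
      _ = (√s * √2 ^ l) ^ 2 := by rw [mul_pow, Real.sq_sqrt hs0, hrr]; ring
  have hmain := norm_avg_add_sub_avg_le hT f k t s ht hts
  have hsum : ∑ l ∈ Finset.range (k + 2), min ((2 : ℝ) ^ l) s * dyadicGap T f l
      ≤ √s * √2 ^ (k + 2) * geomConv √2 (dyadicGap T f) (k + 2) := by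
    rw [geomConv, Finset.mul_sum]
    refine Finset.sum_le_sum fun l _ => ?_
    calc min ((2 : ℝ) ^ l) s * dyadicGap T f l ≤ √s * √2 ^ l * dyadicGap T f l :=
          mul_le_mul_of_nonneg_right (hmin l) (he l)
      _ = _ := by field_simp
  have hle : D ≤ 20 * geomConv √2 (dyadicGap T f) (k + 2) * √(s / 2 ^ k) := by
    have h2 : √(s / 2 ^ k) = √s / √2 ^ k := by
      rw [Real.sqrt_div hs0, hrr, Real.sqrt_mul_self (by positivity)]
    rw [h2, ← mul_le_mul_iff_right₀ (by positivity : (0 : ℝ) < 2 ^ k)]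
    refine (hmain.trans (mul_le_mul_of_nonneg_left hsum (by norm_num))).trans_eq ?_
    rw [hrr, pow_add, Real.sq_sqrt (by norm_num)]
    field_simp
    ring
  have hG := geomConv_nonneg hr0.le he (k + 2)
  have hsqrt : √(s / 2 ^ k) ^ p ≤ (s : ℝ) / 2 ^ k := by
    rw [Real.sqrt_eq_rpow, ← Real.rpow_mul hσ0]
    exact Real.rpow_le_self_of_le_one hσ0 hσ1 (by linarith)
  calc D ^ p ≤ (20 * geomConv √2 (dyadicGap T f) (k + 2) * √(s / 2 ^ k)) ^ p :=
        Real.rpow_le_rpow (norm_nonneg _) hle (by linarith)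
    _ = 20 ^ p * geomConv √2 (dyadicGap T f) (k + 2) ^ p * √(s / 2 ^ k) ^ p := by
        rw [Real.mul_rpow (by positivity) (by positivity), Real.mul_rpow (by norm_num) hG]
    _ ≤ 20 ^ p * ((√2 - 1)⁻¹ ^ p * geomConv √2 (fun l => dyadicGap T f l ^ p) (k + 2))
          * (s / 2 ^ k) := by
        have hJ := geomConv_rpow_le hr1 hr2 (by linarith : 1 ≤ p) he (k + 2)
        have h20 : (0 : ℝ) ≤ 20 ^ p := by positivity
        refine mul_le_mul (mul_le_mul_of_nonneg_left hJ h20) hsqrt (by positivity) ?_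
        exact mul_nonneg h20 ((Real.rpow_nonneg hG p).trans hJ)
    _ = _ := by
        rw [Real.mul_rpow (by norm_num) (inv_nonneg.2 (by linarith))]
        ring

end Orbit

/-- The gaps of an increasing sequence inside a dyadic block have total length at most that of
the block. -/
lemma tsum_dyadic_block_gaps_le {t : ℕ → ℕ} (ht : Monotone t) (k : ℕ) :
    ∑' i : ℕ, (if 2 ^ k ≤ t i ∧ t i ≤ 2 ^ (k + 1) ∧ 2 ^ k ≤ t (i + 1) ∧ t (i + 1) ≤ 2 ^ (k + 1)
      then ENNReal.ofReal (((t (i + 1) - t i : ℕ) : ℝ) / 2 ^ k) else 0) ≤ 1 := by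
  set c : ℕ → ℕ := fun i => min (max (t i) (2 ^ k)) (2 ^ (k + 1)) with hc
  have hpow : 2 ^ (k + 1) = 2 * 2 ^ k := pow_succ' 2 k
  have hstep : ∀ i, (if 2 ^ k ≤ t i ∧ t i ≤ 2 ^ (k + 1) ∧ 2 ^ k ≤ t (i + 1) ∧
      t (i + 1) ≤ 2 ^ (k + 1) then t (i + 1) - t i else 0) + c i ≤ c (i + 1) := fun i => by
    have := ht i.le_succ
    simp only [hc, Nat.succ_eq_add_one] at *
    split_ifs <;> omega
  have hsum : ∀ N, ∑ i ∈ Finset.range N, (if 2 ^ k ≤ t i ∧ t i ≤ 2 ^ (k + 1) ∧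
      2 ^ k ≤ t (i + 1) ∧ t (i + 1) ≤ 2 ^ (k + 1) then t (i + 1) - t i else 0) + c 0 ≤ c N := by
    intro N
    induction N with
    | zero => simp
    | succ N ih =>
      rw [Finset.sum_range_succ]
      have := hstep N
      omega
  refine ENNReal.tsum_le_of_sum_range_le fun N => ?_
  have hN := hsum N
  have hle : ∑ i ∈ Finset.range N, (if 2 ^ k ≤ t i ∧ t i ≤ 2 ^ (k + 1) ∧
      2 ^ k ≤ t (i + 1) ∧ t (i + 1) ≤ 2 ^ (k + 1) then t (i + 1) - t i else 0) ≤ 2 ^ k := by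
    simp only [hc] at hN
    omega
  have hterm : ∀ i, (if 2 ^ k ≤ t i ∧ t i ≤ 2 ^ (k + 1) ∧ 2 ^ k ≤ t (i + 1) ∧
        t (i + 1) ≤ 2 ^ (k + 1)
        then ENNReal.ofReal (((t (i + 1) - t i : ℕ) : ℝ) / 2 ^ k) else 0)
      = ENNReal.ofReal (((if 2 ^ k ≤ t i ∧ t i ≤ 2 ^ (k + 1) ∧ 2 ^ k ≤ t (i + 1) ∧
        t (i + 1) ≤ 2 ^ (k + 1) then t (i + 1) - t i else 0 : ℕ) : ℝ) / 2 ^ k) := fun i => by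
    split_ifs <;> simp
  simp only [hterm]
  rw [← ENNReal.ofReal_sum_of_nonneg fun i _ => by positivity, ← Finset.sum_div, ← Nat.cast_sum]
  refine ENNReal.ofReal_le_one.2 ((div_le_one (by positivity)).2 ?_)
  exact_mod_cast hle

section Orbit

variable {X : Type*} [NormedAddCommGroup X] [NormedSpace ℝ X]

/-- The short `p`-variation bound for the ergodic averages of a contraction on a `p`-uniformly
convex space. -/
lemma tsum_short_variation_le {T : X →ₗ[ℝ] X} (hT : ∀ x, ‖T x‖ ≤ ‖x‖) {p δ : ℝ} (hp : 2 ≤ p)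
    (hδ : 0 < δ)
    (hX : ∀ x y : X, ‖(1 / 2 : ℝ) • (x + y)‖ ^ p + δ * ‖x - y‖ ^ p ≤ (‖x‖ ^ p + ‖y‖ ^ p) / 2)
    (f : X) {t : ℕ → ℕ} (ht : Monotone t) :
    ∑' k : ℕ, ∑' i : ℕ,
        (if 2 ^ k ≤ t i ∧ t i ≤ 2 ^ (k + 1) ∧ 2 ^ k ≤ t (i + 1) ∧ t (i + 1) ≤ 2 ^ (k + 1)
          then ENNReal.ofReal (‖(t (i + 1) : ℝ)⁻¹ • orbitSum T f (t (i + 1))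
            - (t i : ℝ)⁻¹ • orbitSum T f (t i)‖ ^ p)
          else 0)
      ≤ ENNReal.ofReal ((20 * (√2 - 1)⁻¹) ^ p * ((√2 - 1)⁻¹ * δ⁻¹)) *
        ENNReal.ofReal (‖f‖ ^ p) := by
  set V := geomConv √2 (fun l => dyadicGap T f l ^ p) with hV
  set A : ℝ := (20 * (√2 - 1)⁻¹) ^ p with hA
  have hr1 : 0 < √2 - (1 : ℝ) := sub_pos.2 (Real.lt_sqrt_of_sq_lt (by norm_num))
  have hA0 : 0 ≤ A := by positivity
  have he : ∀ l, 0 ≤ dyadicGap T f l ^ p := fun l => Real.rpow_nonneg (dyadicGap_nonneg T f l) p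
  have hV0 : ∀ n, 0 ≤ V n := geomConv_nonneg (Real.sqrt_nonneg 2) he
  have hblock : ∀ k : ℕ, ∑' i : ℕ,
        (if 2 ^ k ≤ t i ∧ t i ≤ 2 ^ (k + 1) ∧ 2 ^ k ≤ t (i + 1) ∧ t (i + 1) ≤ 2 ^ (k + 1)
          then ENNReal.ofReal (‖(t (i + 1) : ℝ)⁻¹ • orbitSum T f (t (i + 1))
            - (t i : ℝ)⁻¹ • orbitSum T f (t i)‖ ^ p)
          else 0) ≤ ENNReal.ofReal (A * V (k + 2)) := fun k => by
    calc _ ≤ ∑' i : ℕ, ENNReal.ofReal (A * V (k + 2)) *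
          (if 2 ^ k ≤ t i ∧ t i ≤ 2 ^ (k + 1) ∧ 2 ^ k ≤ t (i + 1) ∧ t (i + 1) ≤ 2 ^ (k + 1)
            then ENNReal.ofReal (((t (i + 1) - t i : ℕ) : ℝ) / 2 ^ k) else 0) := by
          refine ENNReal.tsum_le_tsum fun i => ?_
          split_ifs with h
          · obtain ⟨s, hs⟩ := Nat.exists_eq_add_of_le (ht i.le_succ)
            rw [Nat.succ_eq_add_one] at hs
            rw [← ENNReal.ofReal_mul (mul_nonneg hA0 (hV0 _)), hs, Nat.add_sub_cancel_left]
            exact ENNReal.ofReal_le_ofReal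
              (norm_avg_add_sub_avg_rpow_le hT f hp k (t i) s h.1 (hs ▸ h.2.2.2))
          · simp
      _ ≤ ENNReal.ofReal (A * V (k + 2)) * 1 := by
          rw [ENNReal.tsum_mul_left]
          exact mul_le_mul_right (tsum_dyadic_block_gaps_le ht k) _
      _ = _ := mul_one _
  refine (ENNReal.tsum_le_tsum hblock).trans (ENNReal.tsum_le_of_sum_range_le fun N => ?_)
  rw [← ENNReal.ofReal_sum_of_nonneg fun k _ => mul_nonneg hA0 (hV0 _),
    ← ENNReal.ofReal_mul (by positivity), ← Finset.mul_sum, mul_assoc]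
  refine ENNReal.ofReal_le_ofReal (mul_le_mul_of_nonneg_left ?_ hA0)
  have h1 : ∑ k ∈ Finset.range N, V (k + 2) ≤ ∑ n ∈ Finset.range (N + 2), V n := by
    rw [Finset.sum_range_succ', Finset.sum_range_succ']
    linarith [hV0 0, hV0 (0 + 1)]
  have h2 := sum_geomConv_le (by positivity : (0 : ℝ) < √2) he (N + 2)
  have h3 := sum_dyadicGap_rpow_le hT (by linarith) hX f (N + 2)
  have h4 : (√2 - 1) * ∑ k ∈ Finset.range N, V (k + 2)
      ≤ ∑ n ∈ Finset.range (N + 2), dyadicGap T f n ^ p :=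
    (mul_le_mul_of_nonneg_left h1 hr1.le).trans h2
  rw [mul_assoc, le_inv_mul_iff₀ hr1, le_inv_mul_iff₀ hδ]
  exact (mul_le_mul_of_nonneg_left h4 hδ.le).trans h3

end Orbit

section Shift

variable {B : Type*} [NormedAddCommGroup B] {p : ℝ}

lemma lp_hasSum_norm_rpow (hp : 0 < p) (f : lp (fun _ : ℤ => B) (ENNReal.ofReal p)) :
    HasSum (fun x => ‖f x‖ ^ p) (‖f‖ ^ p) := by
  have h := lp.hasSum_norm (by rwa [ENNReal.toReal_ofReal hp.le]) f
  rwa [ENNReal.toReal_ofReal hp.le] at h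

lemma lp_tsum_nnnorm_rpow (hp : 0 < p) (f : lp (fun _ : ℤ => B) (ENNReal.ofReal p)) :
    ∑' x : ℤ, (‖f x‖₊ : ℝ≥0∞) ^ p = ENNReal.ofReal (‖f‖ ^ p) := by
  have h := lp_hasSum_norm_rpow hp f
  rw [← h.tsum_eq, ENNReal.ofReal_tsum_of_nonneg (fun x => by positivity) h.summable]
  refine tsum_congr fun x => ?_
  rw [← ENNReal.ofReal_rpow_of_nonneg (norm_nonneg _) hp.le, ofReal_norm, enorm_eq_nnnorm]

lemma memℓp_comp_add_one (hp : 0 < p) {f : ℤ → B} (hf : Memℓp f (ENNReal.ofReal p)) :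
    Memℓp (fun x => f (x + 1)) (ENNReal.ofReal p) := by
  have hp' : 0 < (ENNReal.ofReal p).toReal := by rwa [ENNReal.toReal_ofReal hp.le]
  exact memℓp_gen ((hf.summable hp').comp_injective (add_left_injective (1 : ℤ)))

variable [NormedSpace ℝ B]

/-- The shift on `ℓ^p(B)` as a linear map. -/
def lpShift (B : Type*) [NormedAddCommGroup B] [NormedSpace ℝ B] (hp : 0 < p) :
    lp (fun _ : ℤ => B) (ENNReal.ofReal p) →ₗ[ℝ] lp (fun _ : ℤ => B) (ENNReal.ofReal p) where
  toFun f := ⟨fun x => f (x + 1), memℓp_comp_add_one hp (lp.memℓp f)⟩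
  map_add' _ _ := rfl
  map_smul' _ _ := rfl

lemma lpShift_apply (hp : 0 < p) (f : lp (fun _ : ℤ => B) (ENNReal.ofReal p)) (x : ℤ) :
    lpShift B hp f x = f (x + 1) := rfl

lemma lpShift_pow_apply (hp : 0 < p) (f : lp (fun _ : ℤ => B) (ENNReal.ofReal p)) (n : ℕ)
    (x : ℤ) : ((lpShift B hp ^ n) f) x = f (x + n) := by
  induction n generalizing x with
  | zero => simp
  | succ n ih =>
    rw [pow_succ', Module.End.mul_apply, lpShift_apply, ih,
      show x + 1 + (n : ℤ) = x + ((n + 1 : ℕ) : ℤ) by push_cast; ring]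

lemma norm_lpShift_rpow (hp : 0 < p) (f : lp (fun _ : ℤ => B) (ENNReal.ofReal p)) :
    ‖lpShift B hp f‖ ^ p = ‖f‖ ^ p :=
  (lp_hasSum_norm_rpow hp (lpShift B hp f)).unique
    ((Equiv.addRight (1 : ℤ)).hasSum_iff.2 (lp_hasSum_norm_rpow hp f))

lemma norm_lpShift_le (hp : 0 < p) (f : lp (fun _ : ℤ => B) (ENNReal.ofReal p)) :
    ‖lpShift B hp f‖ ≤ ‖f‖ :=
  (Real.rpow_le_rpow_iff (lp.norm_nonneg' _) (lp.norm_nonneg' _) hp).1 (norm_lpShift_rpow hp f).le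

lemma lp_norm_half_add_rpow_le (hp : 0 < p) {δ : ℝ}
    (hB : ∀ x y : B, ‖(1 / 2 : ℝ) • (x + y)‖ ^ p + δ * ‖x - y‖ ^ p ≤ (‖x‖ ^ p + ‖y‖ ^ p) / 2)
    (f g : lp (fun _ : ℤ => B) (ENNReal.ofReal p)) :
    ‖(1 / 2 : ℝ) • (f + g)‖ ^ p + δ * ‖f - g‖ ^ p ≤ (‖f‖ ^ p + ‖g‖ ^ p) / 2 :=
  hasSum_le (fun x => hB (f x) (g x))
    ((lp_hasSum_norm_rpow hp ((1 / 2 : ℝ) • (f + g))).add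
      ((lp_hasSum_norm_rpow hp (f - g)).mul_left δ))
    (((lp_hasSum_norm_rpow hp f).add (lp_hasSum_norm_rpow hp g)).div_const 2)

lemma smul_orbitSum_lpShift_apply [Fact (1 ≤ ENNReal.ofReal p)] (hp : 0 < p)
    (f : lp (fun _ : ℤ => B) (ENNReal.ofReal p)) (n : ℕ) (x : ℤ) : ((n : ℝ)⁻¹ • orbitSum (lpShift B hp) f n) x = shiftAvg n f x := by
  rw [lp.coeFn_smul, Pi.smul_apply, shiftAvg, orbitSum, lp.coeFn_sum, Finset.sum_apply]
  simp only [lpShift_pow_apply]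

end Shift

/-- For `p ≥ 2`, `K > 0` there is `C > 0` depending only on `p` and `K` such that for every real
Banach space `B` with modulus of uniform convexity `η(ε) = K ε^p`, every `f ∈ ℓ^p(B)` and every
strictly increasing sequence `(t i)` of positive integers,
`∑ₖ ∑_{i ∈ S k} ‖A_{t(i+1)} f − A_{t i} f‖_{ℓ^p(B)}^p ≤ C ‖f‖_{ℓ^p(B)}^p`, where
`S k = {i : t i ∈ [2^{k-1}, 2^k] ∧ t (i+1) ∈ [2^{k-1}, 2^k]}` (here the outer sum is indexed
so that `k+1` plays the role of `k ≥ 1`, with interval `[2^k, 2^{k+1}]`; since the `t i` are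
positive, these intervals cover all of them). Norms are written out as sums over `ℤ` in `ℝ≥0∞`. -/
theorem stmt8 (p K : ℝ) (hp : 2 ≤ p) (hK : 0 < K) :
    ∃ C : ℝ, 0 < C ∧
      ∀ (B : Type*) [NormedAddCommGroup B] [NormedSpace ℝ B] [CompleteSpace B],
        (∀ ε ∈ Set.Ioc (0 : ℝ) 2, ∀ x y : B, ‖x‖ ≤ 1 → ‖y‖ ≤ 1 → ε ≤ ‖x - y‖ →
          ‖(1 / 2 : ℝ) • (x + y)‖ ≤ 1 - K * ε ^ p) →
        ∀ f : ℤ → B, Memℓp f (ENNReal.ofReal p) →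
        ∀ t : ℕ → ℕ, StrictMono t → (∀ i, 0 < t i) →
          ∑' k : ℕ, ∑' i : ℕ,
              (if 2 ^ k ≤ t i ∧ t i ≤ 2 ^ (k + 1) ∧ 2 ^ k ≤ t (i + 1) ∧ t (i + 1) ≤ 2 ^ (k + 1)
                then ∑' x : ℤ, (‖shiftAvg (t (i + 1)) f x - shiftAvg (t i) f x‖₊ : ℝ≥0∞) ^ p
                else 0)
            ≤ ENNReal.ofReal C * ∑' x : ℤ, (‖f x‖₊ : ℝ≥0∞) ^ p := by
  have hp0 : 0 < p := by linarith
  have hr1 : 0 < √2 - (1 : ℝ) := sub_pos.2 (Real.lt_sqrt_of_sq_lt (by norm_num))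
  have hδ : 0 < min ((1 / 8 : ℝ) ^ p) (K * (1 / 4) ^ p) := lt_min (by positivity) (by positivity)
  refine ⟨(20 * (√2 - 1)⁻¹) ^ p * ((√2 - 1)⁻¹ * (min ((1 / 8 : ℝ) ^ p) (K * (1 / 4) ^ p))⁻¹),
    by positivity, ?_⟩
  intro B _ _ _ hB f hf t ht _
  have : Fact (1 ≤ ENNReal.ofReal p) := ⟨ENNReal.one_le_ofReal.2 (by linarith)⟩
  set F : lp (fun _ : ℤ => B) (ENNReal.ofReal p) := ⟨f, hf⟩
  have main := tsum_short_variation_le (norm_lpShift_le (B := B) hp0) hp hδ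
    (lp_norm_half_add_rpow_le hp0 (norm_half_add_rpow_le hp hK hB)) F ht.monotone
  have hdiff : ∀ m n : ℕ, ∑' x : ℤ, (‖shiftAvg m f x - shiftAvg n f x‖₊ : ℝ≥0∞) ^ p
      = ENNReal.ofReal (‖(m : ℝ)⁻¹ • orbitSum (lpShift B hp0) F m
        - (n : ℝ)⁻¹ • orbitSum (lpShift B hp0) F n‖ ^ p) := fun m n => by
    rw [← lp_tsum_nnnorm_rpow hp0]
    refine tsum_congr fun x => ?_
    rw [lp.coeFn_sub, Pi.sub_apply, smul_orbitSum_lpShift_apply, smul_orbitSum_lpShift_apply]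
  have hnorm : ∑' x : ℤ, (‖f x‖₊ : ℝ≥0∞) ^ p = ENNReal.ofReal (‖F‖ ^ p) :=
    lp_tsum_nnnorm_rpow hp0 F
  rw [hnorm]
  simp only [hdiff]
  exact main
end
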